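/- arXiv:1801.09976 — 2 statements merged into one kernel-verified Lean document; each statement's English description precedes it below -/
import Mathlib

section
/- Let A be a fixed symmetric 5×5 matrix with integer entries and det(A) ≠ 0. For every ε > 0 there is a constant C (depending only on ε and A) such that for all P ≥ 1, the number of symmetric 5×5 integer matrices B = (b_ij) with |b_ij| ≤ P for all 1 ≤ i ≤ j ≤ 5, for which the binary quintic form f(λ,μ) = det(λA + μB) ∈ ℚ[λ,μ] has a nontrivial rational zero (λ,μ) ≠ (0,0) or splits off a factor of degree 2 over ℚ, is at most C · P^{14 + 1/5 + ε}. -/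
open MvPolynomial

/-- The characteristic form `f(λ,μ) = det(λA + μB)` as a polynomial in two
variables over `ℚ`, for integer matrices `A`, `B`. Variable `0` is `λ`,
variable `1` is `μ`. -/
noncomputable def charForm (A B : Matrix (Fin 5) (Fin 5) ℤ) : MvPolynomial (Fin 2) ℚ :=
  Matrix.det (Matrix.of fun i j =>
    X 0 * C ((A i j : ℚ)) + X 1 * C ((B i j : ℚ)))

/-- The divisor bound `τ(n) ≪ n ^ δ`. -/
theorem exists_card_divisors_le_rpow (δ : ℝ) (hδ : 0 < δ) :
    ∃ K : ℝ, 0 < K ∧ ∀ n : ℕ, n ≠ 0 → (n.divisors.card : ℝ) ≤ K * (n : ℝ) ^ δ := by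
  obtain ⟨M, hM⟩ := exists_nat_ge ((2 : ℝ) ^ δ⁻¹)
  set k : ℝ := max 1 (δ * Real.log 2)⁻¹ with hk
  have hlog : 0 < δ * Real.log 2 := mul_pos hδ (Real.log_pos one_lt_two)
  have hk1 : 1 ≤ k := le_max_left _ _
  have hk2 : 1 ≤ k * (δ * Real.log 2) := by
    rw [← inv_mul_cancel₀ hlog.ne']
    exact mul_le_mul_of_nonneg_right (le_max_right _ _) hlog.le
  have hsmall (p e : ℕ) (hp : 2 ≤ p) : (e + 1 : ℝ) ≤ k * ((p : ℝ) ^ e) ^ δ := by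
    have h1 : ((2 : ℝ) ^ e) ^ δ ≤ ((p : ℝ) ^ e) ^ δ := by
      have : (2 : ℝ) ≤ p := by exact_mod_cast hp
      gcongr
    have h2 : ((2 : ℝ) ^ e) ^ δ = Real.exp (e * (δ * Real.log 2)) := by
      rw [← Real.rpow_natCast, ← Real.rpow_mul zero_le_two, Real.rpow_def_of_pos two_pos]
      ring_nf
    have h3 := Real.add_one_le_exp (e * (δ * Real.log 2))
    have he : (0 : ℝ) ≤ e := e.cast_nonneg
    nlinarith
  have hlarge (p e : ℕ) (hp : M ≤ p) : (e + 1 : ℝ) ≤ ((p : ℝ) ^ e) ^ δ := by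
    have hp' : (2 : ℝ) ^ δ⁻¹ ≤ p := hM.trans (by exact_mod_cast hp)
    have h1 : (((2 : ℝ) ^ δ⁻¹) ^ e) ^ δ ≤ ((p : ℝ) ^ e) ^ δ := by gcongr
    have h2 : (((2 : ℝ) ^ δ⁻¹) ^ e) ^ δ = 2 ^ e := by
      rw [← Real.rpow_natCast, ← Real.rpow_natCast, ← Real.rpow_mul zero_le_two,
        ← Real.rpow_mul zero_le_two]
      congr 1
      field_simp
    have h3 : (e + 1 : ℝ) ≤ 2 ^ e := by exact_mod_cast Nat.succ_le_of_lt Nat.lt_two_pow_self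
    linarith
  refine ⟨k ^ M, by positivity, fun n hn => ?_⟩
  have hterm (p : ℕ) (hp : p ∈ n.primeFactors) : (n.factorization p + 1 : ℝ) ≤
      (if p < M then k else 1) * ((p : ℝ) ^ n.factorization p) ^ δ := by
    split_ifs with h
    · exact hsmall p _ (Nat.prime_of_mem_primeFactors hp).two_le
    · simpa using hlarge p _ (not_lt.1 h)
  have hprod : ∏ p ∈ n.primeFactors, (if p < M then k else 1) ≤ k ^ M := by
    rw [Finset.prod_ite, Finset.prod_const_one, mul_one, Finset.prod_const]
    refine pow_le_pow_right₀ hk1 ?_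
    calc _ ≤ (Finset.range M).card := Finset.card_le_card fun p hp => by
          simpa using (Finset.mem_filter.1 hp).2
      _ = M := Finset.card_range M
  calc (n.divisors.card : ℝ) = ∏ p ∈ n.primeFactors, (n.factorization p + 1 : ℝ) := by
        rw [Nat.card_divisors hn]; push_cast; rfl
    _ ≤ ∏ p ∈ n.primeFactors, (if p < M then k else 1) * ((p : ℝ) ^ n.factorization p) ^ δ :=
        Finset.prod_le_prod (fun _ _ => by positivity) hterm
    _ = (∏ p ∈ n.primeFactors, (if p < M then k else 1)) * (n : ℝ) ^ δ := by
        rw [Finset.prod_mul_distrib, Real.finsetProd_rpow _ _ (fun _ _ => by positivity)]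
        congr 2
        conv_rhs => rw [← Nat.prod_factorization_pow_eq_self hn]
        simp [Finsupp.prod]
    _ ≤ k ^ M * (n : ℝ) ^ δ := by gcongr

open Finset in
/-- A nonzero polynomial has few zeros in the integer box of radius `N`. -/
theorem exists_card_zeros_le {σ : Type*} [Fintype σ] [DecidableEq σ] {p : MvPolynomial σ ℤ}
    (hp : p ≠ 0) (n : ℕ) (hn : Fintype.card σ = n + 1) (N : ℕ) :
    #{z ∈ Fintype.piFinset fun _ : σ => Icc (-(N : ℤ)) N | eval z p = 0} ≤
      p.totalDegree * (2 * N + 1) ^ n := by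
  let e : σ ≃ Fin (n + 1) := Fintype.equivFinOfCardEq hn
  have hp' : rename e p ≠ 0 := by
    simpa using (rename_injective e e.injective).ne hp
  have hsz := schwartz_zippel_totalDegree hp' (Icc (-(N : ℤ)) N)
  have hcard : #(Icc (-(N : ℤ)) N) = 2 * N + 1 := by simp; omega
  have hle : #{z ∈ Fintype.piFinset fun _ : σ => Icc (-(N : ℤ)) N | eval z p = 0} ≤
      #{z ∈ Fintype.piFinset fun _ : Fin (n + 1) => Icc (-(N : ℤ)) N |
        eval z (rename e p) = 0} := by
    refine card_le_card_of_injOn (fun z => z ∘ e.symm) (fun z hz => ?_) (fun z _ w _ h => ?_)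
    · simp only [coe_filter, Fintype.mem_piFinset, Set.mem_ofPred_eq, eval_rename] at hz ⊢
      exact ⟨fun i => hz.1 _, by simpa [Function.comp_assoc] using hz.2⟩
    · exact e.symm.surjective.injective_comp_right h
  have hdeg : (rename e p).totalDegree ≤ p.totalDegree := totalDegree_rename_le _ _
  rw [hcard, div_le_div_iff₀ (by positivity) (by positivity), pow_succ] at hsz
  norm_cast at hsz
  rw [← mul_assoc] at hsz
  exact hle.trans ((le_of_mul_le_mul_right hsz (by positivity)).trans (by gcongr))

/-- An integer polynomial grows at most polynomially. -/
theorem exists_abs_eval_le {σ : Type*} [Fintype σ] (p : MvPolynomial σ ℤ) :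
    ∃ L : ℕ, ∀ N : ℕ, 1 ≤ N → ∀ z : σ → ℤ, (∀ i, |z i| ≤ N) →
      |eval z p| ≤ L * N ^ p.totalDegree := by
  refine ⟨∑ m ∈ p.support, (coeff m p).natAbs, fun N hN z hz => ?_⟩
  rw [eval_eq, Nat.cast_sum, Finset.sum_mul]
  refine (Finset.abs_sum_le_sum_abs _ _).trans (Finset.sum_le_sum fun m hm => ?_)
  rw [abs_mul, Int.natCast_natAbs]
  gcongr
  rw [Finset.abs_prod]
  calc ∏ i ∈ m.support, |z i ^ m i| ≤ ∏ i ∈ m.support, (N : ℤ) ^ m i :=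
        Finset.prod_le_prod (fun _ _ => abs_nonneg _) fun i _ => by
          rw [abs_pow]; exact pow_le_pow_left₀ (abs_nonneg _) (hz i) _
    _ = (N : ℤ) ^ (m.sum fun _ e => e) := by rw [Finset.prod_pow_eq_pow_sum]; rfl
    _ ≤ (N : ℤ) ^ p.totalDegree :=
        pow_le_pow_right₀ (by exact_mod_cast hN) (le_totalDegree hm)

/-- A determinant of polynomials of degree at most `k`. -/
theorem natDegree_det_le {n R : Type*} [Fintype n] [DecidableEq n] [CommRing R]
    (M : Matrix n n (Polynomial R)) (k : ℕ) (h : ∀ i j, (M i j).natDegree ≤ k) :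
    M.det.natDegree ≤ Fintype.card n * k := by
  rw [Matrix.det_apply]
  refine Polynomial.natDegree_sum_le_of_forall_le _ _ fun g _ => ?_
  refine (Polynomial.natDegree_smul_le _ _).trans ((Polynomial.natDegree_prod_le _ _).trans ?_)
  refine (Finset.sum_le_card_nsmul _ _ k fun i _ => h _ _).trans ?_
  simp

open Polynomial in
theorem exists_elimination_polynomial {K : Type*} [Field K] [IsAlgClosed K] (b r : K[X])
    (hb : b.Monic) (hdeg : b.natDegree = 4) (hr : r.natDegree ≤ 3)
    (hbr : ∀ x, b.eval x = 0 → r.eval x ≠ 0) (c s : K) (hs : s ≠ 0) :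
    ∃ Ω : K[X], Ω ≠ 0 ∧ Ω.natDegree ≤ 32 ∧ ∀ t x y : K,
      (c * x + t) * b.eval x + r.eval x = 0 → (c * y + t) * b.eval y + r.eval y = 0 →
      b.eval x * b.eval y = s → Ω.eval x = 0 := by
  have hbe (x : K) : b.eval x =
      b.coeff 0 + b.coeff 1 * x + b.coeff 2 * x ^ 2 + b.coeff 3 * x ^ 3 + x ^ 4 := by
    rw [eval_eq_sum_range, hdeg]
    have h4 : b.coeff 4 = 1 := by rw [← hdeg]; exact hb
    simp [Finset.sum_range_succ, h4]
  have hre (x : K) : r.eval x =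
      r.coeff 0 + r.coeff 1 * x + r.coeff 2 * x ^ 2 + r.coeff 3 * x ^ 3 := by
    rw [eval_eq_sum_range' (n := 4) (by omega)]
    simp [Finset.sum_range_succ]
  generalize b.coeff 0 = b0, b.coeff 1 = b1, b.coeff 2 = b2, b.coeff 3 = b3 at hbe
  generalize r.coeff 0 = r0, r.coeff 1 = r1, r.coeff 2 = r2, r.coeff 3 = r3 at hre
  obtain ⟨m, hm⟩ : ∃ m, m = r2 - r3 * b3 := ⟨_, rfl⟩
  obtain ⟨n, hn⟩ : ∃ n, n = r1 - r3 * b2 - m * b3 := ⟨_, rfl⟩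
  let D : K[X] := Polynomial.C s * r + Polynomial.C (s * c) * (b * Polynomial.X)
  let U₀ : Matrix (Fin 4) (Fin 4) K := !![0, 0, 0, 0; 0, 0, 0, 0; 0, 0, 0, 0; s * c * s, 0, 0, 0]
  let U₁ : Matrix (Fin 4) (Fin 4) K := !![
    0, s * c, 0, 0;
    r3 * s, 0, s * c, 0;
    m * s, r3 * s, 0, s * c;
    n * s - s * c * b0, m * s - s * c * b1, r3 * s - s * c * b2, -(s * c * b3)]
  let U₂ : Matrix (Fin 4) (Fin 4) K := !![
    r0, r1, r2, r3;
    -(r3 * b0), r0 - r3 * b1, r1 - r3 * b2, m;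
    -(m * b0), -(r3 * b0 + m * b1), r0 - r3 * b1 - m * b2, n;
    -(n * b0), -(m * b0 + n * b1), -(r3 * b0 + m * b1 + n * b2),
      r0 - r3 * b1 - m * b2 - n * b3]
  let N : Matrix (Fin 4) (Fin 4) K[X] := Matrix.of fun i j =>
    Polynomial.C (U₀ i j) + Polynomial.C (U₁ i j) * b + Polynomial.C (U₂ i j) * b ^ 2 -
      Polynomial.C ((1 : Matrix (Fin 4) (Fin 4) K) i j) * D
  have heval (x : K) : N.det.eval x =
      (U₀ + b.eval x • U₁ + b.eval x ^ 2 • U₂ - D.eval x • 1).det := by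
    refine (RingHom.map_det (evalRingHom x) N).trans (congrArg _ ?_)
    ext i j
    simp [N, mul_comm]
  have hDe (x : K) : D.eval x = s * r.eval x + s * c * (b.eval x * x) := by simp [D]
  have h1 : (1 : Matrix (Fin 4) (Fin 4) K) =
      !![1, 0, 0, 0; 0, 1, 0, 0; 0, 0, 1, 0; 0, 0, 0, 1] := by
    ext i j
    fin_cases i <;> fin_cases j <;> simp
  refine ⟨N.det, fun h0 => ?_, ?_, fun t x y hx hy hxy => ?_⟩
  · obtain ⟨x, hx⟩ := IsAlgClosed.exists_root b (by
      rw [degree_eq_natDegree hb.ne_zero, hdeg]; decide)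
    have hx' : b.eval x = 0 := hx
    have := heval x
    rw [h0, Polynomial.eval_zero, hx', hDe, hx'] at this
    refine pow_ne_zero 4 (mul_ne_zero hs (hbr x hx')) (Eq.trans ?_ this.symm)
    simp [h1, U₀, Matrix.det_succ_row_zero, Fin.sum_univ_succ, Fin.succAbove]
    ring
  · have hb2 : (b ^ 2).natDegree ≤ 8 := natDegree_pow_le_of_le 2 hdeg.le
    have hb1 : b.natDegree ≤ 8 := by omega
    have hD : D.natDegree ≤ 8 := by
      refine natDegree_add_le_of_degree_le ((natDegree_C_mul_le _ _).trans (by omega))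
        ((natDegree_C_mul_le _ _).trans ?_)
      exact (natDegree_mul_le.trans (add_le_add hdeg.le natDegree_X_le)).trans (by norm_num)
    have hC (u : K) {f : K[X]} (hf : f.natDegree ≤ 8) : (Polynomial.C u * f).natDegree ≤ 8 :=
      (natDegree_C_mul_le _ _).trans hf
    refine natDegree_det_le N 8 fun i j => ?_
    exact (natDegree_sub_le_of_le (natDegree_add_le_of_degree_le (natDegree_add_le_of_degree_le
      (by simp) (hC _ hb1)) (hC _ hb2)) (hC _ hD)).trans (max_self 8).le
  · rw [heval, ← Matrix.exists_mulVec_eq_zero_iff]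
    refine ⟨![1, y, y ^ 2, y ^ 3], fun h => one_ne_zero (congrFun h 0), ?_⟩
    have e1 : s * c * b.eval x * y + (b.eval x) ^ 2 * r.eval y = D.eval x := by
      rw [hDe]
      linear_combination (-s) * hx + (b.eval x) ^ 2 * hy - (b.eval x * (c * y + t)) * hxy
    have e2 : b.eval x * y ^ 4 = s - b.eval x * (b0 + b1 * y + b2 * y ^ 2 + b3 * y ^ 3) := by
      linear_combination hxy - b.eval x * hbe y
    rw [hre y] at e1
    generalize b.eval x = p at e1 e2
    generalize D.eval x = d at e1
    ext i
    fin_cases i <;> simp [h1, U₀, U₁, U₂, Matrix.mulVec, dotProduct, Fin.sum_univ_succ]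
    · linear_combination e1
    · linear_combination y * e1 - r3 * p * e2 + (y ^ 3 * p ^ 2) * hm
    · linear_combination y ^ 2 * e1 - (r3 * p * y + m * p) * e2 +
        (y ^ 4 * p ^ 2) * hm + (y ^ 3 * p ^ 2) * hn
    · linear_combination y ^ 3 * e1 -
        (r3 * p * y ^ 2 + m * p * y + (s * c + n * p)) * e2 +
        (y ^ 5 * p ^ 2) * hm + (y ^ 4 * p ^ 2) * hn

/-- Gauss's lemma: a rational factor of an integer polynomial comes from an integer factor. -/
theorem exists_int_dvd_of_rat_dvd {F : Polynomial ℤ} (hF : F ≠ 0) {g : Polynomial ℚ}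
    (hg : g ∣ F.map (Int.castRingHom ℚ)) :
    ∃ q : Polynomial ℤ, q ∣ F ∧ q.natDegree = g.natDegree := by
  have hg0 : g ≠ 0 := by
    rintro rfl
    exact hF ((Polynomial.map_eq_zero_iff (RingHom.injective_int _)).1 (zero_dvd_iff.1 hg))
  obtain ⟨a, haM, ha⟩ := IsLocalization.integerNormalization_spec (nonZeroDivisors ℤ) g
  set g₀ := IsLocalization.integerNormalization (nonZeroDivisors ℤ) g with hg₀
  have ha0 : a ≠ 0 := nonZeroDivisors.ne_zero haM
  have hag : g₀.map (Int.castRingHom ℚ) = Polynomial.C (a : ℚ) * g := by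
    rw [← Polynomial.smul_eq_C_mul, ← algebraMap_int_eq ℚ, ha, Int.cast_smul_eq_zsmul]
  have haQ : (a : ℚ) ≠ 0 := by exact_mod_cast ha0
  have hnd : g₀.natDegree = g.natDegree := by
    rw [← Polynomial.natDegree_map_eq_of_injective (RingHom.injective_int (Int.castRingHom ℚ)),
      hag, Polynomial.natDegree_C_mul haQ]
  refine ⟨g₀.primPart, ?_, by rw [Polynomial.natDegree_primPart, hnd]⟩
  rw [Polynomial.IsPrimitive.Int.dvd_iff_map_cast_dvd_map_cast _ _ g₀.isPrimitive_primPart]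
  refine dvd_trans ?_ ((Polynomial.isUnit_C.2 (isUnit_iff_ne_zero.2 haQ)).mul_left_dvd.2 hg)
  rw [← hag]
  refine Polynomial.map_dvd _ ?_
  conv_rhs => rw [g₀.eq_C_content_mul_primPart]
  exact dvd_mul_left _ _

open Polynomial in
theorem card_le_of_eval_mul_eval_eq {b r : Polynomial ℤ} (hb : b.natDegree = 4)
    (hr : r.natDegree ≤ 3) (hbr : ∀ x : ℂ, Polynomial.aeval x b = 0 → Polynomial.aeval x r ≠ 0) (c : ℤ) {s : ℂ}
    (hs : s ≠ 0) (T : Finset ℤ) (hT : ∀ t ∈ T, ∃ x y : ℂ,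
      (c * x + t) * Polynomial.aeval x b + Polynomial.aeval x r = 0 ∧ (c * y + t) * Polynomial.aeval y b + Polynomial.aeval y r = 0 ∧
      Polynomial.aeval x b * Polynomial.aeval y b = s) :
    T.card ≤ 32 := by
  set l : ℂ := ((b.leadingCoeff : ℤ) : ℂ) with hl
  have hb0 : b ≠ 0 := by rintro rfl; simp at hb
  have hl0 : l ≠ 0 := by simpa [hl] using hb0
  set φ := algebraMap ℤ ℂ with hφ
  have hinj : Function.Injective φ := (algebraMap ℤ ℂ).injective_int
  have he (f : Polynomial ℤ) (x : ℂ) :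
      (Polynomial.C l⁻¹ * f.map φ).eval x = l⁻¹ * Polynomial.aeval x f := by
    rw [Polynomial.eval_mul, Polynomial.eval_C, hφ, Polynomial.eval_map_algebraMap]
  have hnd : (Polynomial.C l⁻¹ * b.map φ).natDegree = 4 := by
    rw [natDegree_C_mul (inv_ne_zero hl0), natDegree_map_eq_of_injective hinj, hb]
  have hmonic : (Polynomial.C l⁻¹ * b.map φ).Monic := by
    rw [Monic, leadingCoeff_mul, leadingCoeff_C, leadingCoeff_map_of_injective hinj]
    simpa [hl, hφ] using inv_mul_cancel₀ hl0
  obtain ⟨Ω, hΩ0, hΩd, hΩ⟩ := exists_elimination_polynomial (Polynomial.C l⁻¹ * b.map φ)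
    (Polynomial.C l⁻¹ * r.map φ) hmonic hnd
    ((natDegree_C_mul_le _ _).trans (natDegree_map_le.trans hr))
    (fun x hx => by
      rw [he] at hx ⊢
      exact mul_ne_zero (inv_ne_zero hl0)
        (hbr x ((mul_eq_zero.1 hx).resolve_left (inv_ne_zero hl0))))
    c (l⁻¹ * l⁻¹ * s) (by simp [hl0, hs])
  choose! u v hu hv huv using hT
  have hmem : ∀ t ∈ T, u t ∈ Ω.roots.toFinset := fun t ht => by
    rw [Multiset.mem_toFinset, mem_roots hΩ0]
    refine hΩ t (u t) (v t) ?_ ?_ ?_ <;> simp only [he]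
    · linear_combination l⁻¹ * hu t ht
    · linear_combination l⁻¹ * hv t ht
    · linear_combination l⁻¹ * l⁻¹ * huv t ht
  have hinjOn : Set.InjOn u T := fun t ht t' ht' h => by
    have hne : Polynomial.aeval (u t) b ≠ 0 := fun h0 => hs (by rw [← huv t ht, h0, zero_mul])
    have h2 := hu t' ht'
    rw [← h] at h2
    have : ((t : ℂ) - t') * Polynomial.aeval (u t) b = 0 := by linear_combination hu t ht - h2
    exact_mod_cast sub_eq_zero.1 ((mul_eq_zero.1 this).resolve_right hne)
  calc T.card ≤ Ω.roots.toFinset.card := Finset.card_le_card_of_injOn u hmem hinjOn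
    _ ≤ 32 := (Multiset.toFinset_card_le _).trans ((card_roots' _).trans hΩd)

/-- The possible values of `b(x) b(y)` at roots `x`, `y` of a factor of degree one or two of a
polynomial with leading coefficient `D`, whose resultant with `b` is `R`. -/
noncomputable def rootProductCandidates (R D : ℤ) : Finset ℂ :=
  (R.natAbs.divisors ×ˢ D.natAbs.divisors).image (fun e => (e.1 : ℂ) / e.2 ^ 4) ∪
    ((R.natAbs.divisors ×ˢ D.natAbs.divisors).image (fun e => -(e.1 : ℂ) / e.2 ^ 4) ∪
      (R.natAbs.divisors ×ˢ D.natAbs.divisors).image (fun e => ((e.1 : ℂ) / e.2 ^ 4) ^ 2))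

theorem card_rootProductCandidates_le (R D : ℤ) :
    (rootProductCandidates R D).card ≤
      3 * (R.natAbs.divisors.card * D.natAbs.divisors.card) := by
  rw [rootProductCandidates, ← Finset.card_product]
  refine (Finset.card_union_le _ _).trans ((add_le_add Finset.card_image_le
    ((Finset.card_union_le _ _).trans (add_le_add Finset.card_image_le
      Finset.card_image_le))).trans (by omega))

theorem ne_zero_of_mem_rootProductCandidates {R D : ℤ} {s : ℂ}
    (hs : s ∈ rootProductCandidates R D) : s ≠ 0 := by
  have aux (e : ℕ × ℕ) (he : e ∈ R.natAbs.divisors ×ˢ D.natAbs.divisors) :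
      (e.1 : ℂ) ≠ 0 ∧ (e.2 : ℂ) ^ 4 ≠ 0 := by
    rw [Finset.mem_product] at he
    exact ⟨Nat.cast_ne_zero.2 (Nat.pos_of_mem_divisors he.1).ne',
      pow_ne_zero _ (Nat.cast_ne_zero.2 (Nat.pos_of_mem_divisors he.2).ne')⟩
  simp only [rootProductCandidates, Finset.mem_union, Finset.mem_image] at hs
  rcases hs with ⟨e, he, rfl⟩ | ⟨e, he, rfl⟩ | ⟨e, he, rfl⟩ <;> obtain ⟨h1, h2⟩ := aux e he
  · exact div_ne_zero h1 h2
  · exact div_ne_zero (neg_ne_zero.2 h1) h2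
  · exact pow_ne_zero _ (div_ne_zero h1 h2)

open Polynomial in
theorem exists_roots_mul_mem_rootProductCandidates {F b q : Polynomial ℤ} (hF : F.natDegree = 5)
    (hb : b.natDegree ≤ 4) (hR : resultant F b 5 4 ≠ 0) (hq : q ∣ F)
    (hqd : q.natDegree = 1 ∨ q.natDegree = 2) :
    ∃ x y : ℂ, Polynomial.aeval x F = 0 ∧ Polynomial.aeval y F = 0 ∧
      Polynomial.aeval x b * Polynomial.aeval y b ∈ rootProductCandidates (resultant F b 5 4) F.leadingCoeff := by
  obtain ⟨q', rfl⟩ := hq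
  have h0 : q * q' ≠ 0 := by rintro h; simp [h] at hF
  have hq0 : q ≠ 0 := left_ne_zero_of_mul h0
  have hinj : Function.Injective (algebraMap ℤ ℂ) := (algebraMap ℤ ℂ).injective_int
  set d := resultant q b q.natDegree 4 with hd
  have hdR : d ∣ resultant (q * q') b 5 4 := by
    rw [← hF, natDegree_mul hq0 (right_ne_zero_of_mul h0), resultant_mul_left _ _ _ _ hb]
    exact dvd_mul_right _ _
  have hwD : q.leadingCoeff ∣ (q * q').leadingCoeff := by
    rw [leadingCoeff_mul]; exact dvd_mul_right _ _
  have hmem : (d.natAbs, q.leadingCoeff.natAbs) ∈ (resultant (q * q') b 5 4).natAbs.divisors ×ˢ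
      (q * q').leadingCoeff.natAbs.divisors := by
    simp only [Finset.mem_product, Nat.mem_divisors]
    exact ⟨⟨Int.natAbs_dvd_natAbs.2 hdR, by simpa using hR⟩,
      ⟨Int.natAbs_dvd_natAbs.2 hwD, by simpa using h0⟩⟩
  have hw0 : ((q.leadingCoeff : ℤ) : ℂ) ≠ 0 := by simpa using hq0
  have hwabs : ((q.leadingCoeff.natAbs : ℕ) : ℂ) ^ 4 = ((q.leadingCoeff : ℤ) : ℂ) ^ 4 := by
    have : ((q.leadingCoeff.natAbs : ℤ)) ^ 4 = q.leadingCoeff ^ 4 := by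
      rw [Int.natCast_natAbs]; exact Even.pow_abs (by decide) _
    simpa using congrArg (Int.cast : ℤ → ℂ) this
  set Q := q.map (algebraMap ℤ ℂ) with hQ
  have hres : (d : ℂ) / ((q.leadingCoeff : ℤ) : ℂ) ^ 4 = (Q.roots.map fun x => Polynomial.aeval x b).prod := by
    have h1 := resultant_eq_prod_eval Q (b.map (algebraMap ℤ ℂ)) 4 (natDegree_map_le.trans hb)
      (IsAlgClosed.splits Q)
    rw [hQ, natDegree_map_eq_of_injective hinj, resultant_map_map,
      leadingCoeff_map_of_injective hinj] at h1
    rw [div_eq_iff (pow_ne_zero 4 hw0), mul_comm]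
    simp only [Polynomial.eval_map_algebraMap] at h1
    simpa only [hd, hQ, algebraMap_int_eq, eq_intCast] using h1
  have hcard : Q.roots.card = q.natDegree := by
    rw [← natDegree_map_eq_of_injective hinj q]
    exact (IsAlgClosed.splits Q).natDegree_eq_card_roots.symm
  have hroot (x : ℂ) (hx : x ∈ Q.roots) : Polynomial.aeval x (q * q') = 0 := by
    have : Polynomial.aeval x q = 0 := by
      simpa only [hQ, IsRoot.def, Polynomial.eval_map_algebraMap] using (mem_roots'.1 hx).2
    rw [map_mul, this, zero_mul]
  simp only [rootProductCandidates, Finset.mem_union, Finset.mem_image]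
  rcases hqd with h | h <;> rw [h] at hcard
  · obtain ⟨x, hx⟩ := Multiset.card_eq_one.1 hcard
    refine ⟨x, x, hroot x (by simp [hx]), hroot x (by simp [hx]), ?_⟩
    refine Or.inr (Or.inr ⟨_, hmem, ?_⟩)
    have hdabs : ((d.natAbs : ℕ) : ℂ) ^ 2 = (d : ℂ) ^ 2 := by
      have := congrArg (Int.cast : ℤ → ℂ) (Int.natAbs_sq d)
      rwa [Int.cast_pow, Int.cast_pow, Int.cast_natCast] at this
    rw [div_pow, hwabs, hdabs, ← div_pow, hres, hx]
    simp [sq]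
  · obtain ⟨x, y, hx⟩ := Multiset.card_eq_two.1 hcard
    refine ⟨x, y, hroot x (by simp [hx]), hroot y (by simp [hx]), ?_⟩
    have hxy : Polynomial.aeval x b * Polynomial.aeval y b = (d : ℂ) / ((q.leadingCoeff : ℤ) : ℂ) ^ 4 := by
      rw [hres, hx]; simp
    rw [hxy]
    rcases Int.natAbs_eq d with hd' | hd'
    · refine Or.inl ⟨_, hmem, ?_⟩
      rw [hwabs, show (d : ℂ) = (d.natAbs : ℕ) by
        simpa using congrArg (Int.cast : ℤ → ℂ) hd']
    · refine Or.inr (Or.inl ⟨_, hmem, ?_⟩)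
      rw [hwabs, show (d : ℂ) = -(d.natAbs : ℕ) by
        simpa using congrArg (Int.cast : ℤ → ℂ) hd']

open Polynomial in
theorem card_specializations_with_factor_le {b r : Polynomial ℤ} (hb : b.natDegree = 4)
    (hr : r.natDegree ≤ 3) {c : ℤ} (hc : c ≠ 0)
    {R : ℤ} (hR0 : R ≠ 0) (T : Finset ℤ)
    (hT : ∀ t ∈ T, resultant ((Polynomial.C c * Polynomial.X + Polynomial.C t) * b + r) b 5 4 = R ∧
      ∃ q, q ∣ (Polynomial.C c * Polynomial.X + Polynomial.C t) * b + r ∧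
      (q.natDegree = 1 ∨ q.natDegree = 2)) :
    T.card ≤ 96 * (R.natAbs.divisors.card * (c * b.leadingCoeff).natAbs.divisors.card) := by
  classical
  rcases T.eq_empty_or_nonempty with rfl | ⟨t₀, ht₀⟩
  · simp
  have hb0 : b ≠ 0 := by rintro rfl; simp at hb
  have hlin (t : ℤ) : (Polynomial.C c * Polynomial.X + Polynomial.C t).natDegree = 1 :=
    natDegree_linear hc
  have hlin0 (t : ℤ) : Polynomial.C c * Polynomial.X + Polynomial.C t ≠ 0 := fun h => by
    have := hlin t
    rw [h, natDegree_zero] at this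
    omega
  have hlt (t : ℤ) : r.degree <
      ((Polynomial.C c * Polynomial.X + Polynomial.C t) * b).degree := by
    rw [degree_mul, degree_eq_natDegree (hlin0 t), degree_eq_natDegree hb0, hlin, hb]
    exact (degree_le_of_natDegree_le hr).trans_lt (by norm_num)
  have hFd (t : ℤ) : ((Polynomial.C c * Polynomial.X + Polynomial.C t) * b + r).natDegree = 5 := by
    rw [natDegree_add_eq_left_of_degree_lt (hlt t), natDegree_mul (hlin0 t) hb0, hlin, hb]
  have hFl (t : ℤ) : ((Polynomial.C c * Polynomial.X + Polynomial.C t) * b + r).leadingCoeff =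
      c * b.leadingCoeff := by
    rw [leadingCoeff_add_of_degree_lt' (hlt t), leadingCoeff_mul, leadingCoeff_linear hc]
  have haev (t : ℤ) (x : ℂ) : Polynomial.aeval x ((Polynomial.C c * Polynomial.X + Polynomial.C t) * b + r) =
      (c * x + t) * Polynomial.aeval x b + Polynomial.aeval x r := by simp
  have hbr (x : ℂ) (hx : Polynomial.aeval x b = 0) : Polynomial.aeval x r ≠ 0 := fun hxr => by
    obtain ⟨u, v, -, -, huv⟩ := exists_mul_add_mul_eq_C_resultant
      ((Polynomial.C c * Polynomial.X + Polynomial.C t₀) * b + r) b (m := 5) (n := 4)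
      (hFd t₀).le hb.le (by simp)
    rw [(hT t₀ ht₀).1] at huv
    have := congrArg (Polynomial.aeval x) huv
    rw [map_add, map_mul, map_mul, haev, hx, hxr] at this
    simp at this
    exact hR0 (by exact_mod_cast this.symm)
  let S := rootProductCandidates R (c * b.leadingCoeff)
  let Tₛ (s : ℂ) : Finset ℤ := {t ∈ T | ∃ x y : ℂ,
      (c * x + t) * Polynomial.aeval x b + Polynomial.aeval x r = 0 ∧ (c * y + t) * Polynomial.aeval y b + Polynomial.aeval y r = 0 ∧
      Polynomial.aeval x b * Polynomial.aeval y b = s}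
  have hsub : T ⊆ S.biUnion Tₛ := fun t ht => by
    obtain ⟨hres, q, hq, hqd⟩ := hT t ht
    obtain ⟨x, y, hx, hy, hxy⟩ := exists_roots_mul_mem_rootProductCandidates (hFd t) hb.le
      (hres ▸ hR0) hq hqd
    rw [hres, hFl] at hxy
    rw [haev] at hx hy
    exact Finset.mem_biUnion.2 ⟨_, hxy, Finset.mem_filter.2 ⟨ht, x, y, hx, hy, rfl⟩⟩
  calc T.card ≤ (S.biUnion Tₛ).card := Finset.card_le_card hsub
    _ ≤ S.card * 32 := Finset.card_biUnion_le_card_mul _ _ _ fun s hs =>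
        card_le_of_eval_mul_eval_eq hb hr hbr c (ne_zero_of_mem_rootProductCandidates hs) _
          fun t ht => (Finset.mem_filter.1 ht).2
    _ ≤ _ := by
        have := card_rootProductCandidates_le R (c * b.leadingCoeff)
        simp only [S]; omega

/-- The symmetric matrix with entries indexed by unordered pairs. -/
def symmMatrix {n R : Type*} (z : Sym2 n → R) : Matrix n n R :=
  Matrix.of fun i j => z s(i, j)

/-- The pencil `x A + B`. -/
noncomputable def matrixPencil {n R : Type*} [CommRing R] (A B : Matrix n n R) :
    Matrix n n (Polynomial R) :=
  (Polynomial.X : Polynomial R) • A.map Polynomial.C + B.map Polynomial.C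

/-- The matrix `x • diag(d) + B`, where `B` is the symmetric matrix with entries `z`. -/
noncomputable def diagPencil {R : Type*} [CommRing R] {n : ℕ} (d : Fin n → R)
    (z : Sym2 (Fin n) → R) : Matrix (Fin n) (Fin n) (Polynomial R) :=
  matrixPencil (Matrix.diagonal d) (symmMatrix z)

section diagPencil

variable {R : Type*} [CommRing R] {n : ℕ} (d : Fin n → R) (z : Sym2 (Fin n) → R)

theorem diagPencil_apply_self (i : Fin n) :
    diagPencil d z i i = Polynomial.C (d i) * Polynomial.X + Polynomial.C (z s(i, i)) := by
  simp [diagPencil, matrixPencil, symmMatrix, Polynomial.X_mul_C]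

theorem diagPencil_apply_ne {i j : Fin n} (h : i ≠ j) :
    diagPencil d z i j = Polynomial.C (z s(i, j)) := by
  simp [diagPencil, matrixPencil, symmMatrix, h]

theorem natDegree_diagPencil_apply_le (i j : Fin n) : (diagPencil d z i j).natDegree ≤ 1 := by
  rcases eq_or_ne i j with rfl | h
  · rw [diagPencil_apply_self]
    exact Polynomial.natDegree_linear_le
  · simp [diagPencil_apply_ne d z h]

theorem map_diagPencil {S : Type*} [CommRing S] (f : R →+* S) :
    (Polynomial.mapRingHom f).mapMatrix (diagPencil d z) = diagPencil (f ∘ d) (f ∘ z) := by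
  ext1 i j
  rcases eq_or_ne i j with rfl | h
  · simp [diagPencil_apply_self]
  · simp [diagPencil_apply_ne _ _ h]

theorem natDegree_det_diagPencil_le : (diagPencil d z).det.natDegree ≤ n :=
  (Polynomial.natDegree_det_X_add_C_le _ _).trans_eq (Fintype.card_fin n)

theorem coeff_det_diagPencil : (diagPencil d z).det.coeff n = ∏ i, d i := by
  have := Polynomial.coeff_det_X_add_C_card (Matrix.diagonal d) (symmMatrix z)
  rwa [Matrix.det_diagonal, Fintype.card_fin] at this

theorem natDegree_det_diagPencil (hd : ∏ i, d i ≠ 0) : (diagPencil d z).det.natDegree = n :=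
  Polynomial.natDegree_eq_of_le_of_coeff_ne_zero (natDegree_det_diagPencil_le d z)
    (by rwa [coeff_det_diagPencil])

theorem leadingCoeff_det_diagPencil (hd : ∏ i, d i ≠ 0) :
    (diagPencil d z).det.leadingCoeff = ∏ i, d i := by
  rw [Polynomial.leadingCoeff, natDegree_det_diagPencil d z hd, coeff_det_diagPencil]

end diagPencil

section minor

variable {R : Type*} [CommRing R] {n : ℕ} (d : Fin (n + 1) → R) (z : Sym2 (Fin (n + 1)) → R)

/-- The determinant of the lower right block of `diagPencil d z`. -/
noncomputable def pencilMinor : Polynomial R :=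
  (diagPencil (d ∘ Fin.succ) (z ∘ Sym2.map Fin.succ)).det

theorem submatrix_diagPencil : (diagPencil d z).submatrix Fin.succ Fin.succ =
    diagPencil (d ∘ Fin.succ) (z ∘ Sym2.map Fin.succ) := by
  ext1 i j
  rcases eq_or_ne i j with rfl | h
  · simp [diagPencil_apply_self]
  · simp [diagPencil_apply_ne _ _ h, diagPencil_apply_ne _ _ ((Fin.succ_injective n).ne h)]

/-- The part of `det (diagPencil d z)` that does not involve the upper left entry. -/
noncomputable def pencilRemainder : Polynomial R :=
  ∑ j : Fin n, (-1) ^ ((j : ℕ) + 1) * diagPencil d z 0 j.succ *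
    ((diagPencil d z).submatrix Fin.succ j.succ.succAbove).det

theorem det_diagPencil_eq : (diagPencil d z).det =
    (Polynomial.C (d 0) * Polynomial.X + Polynomial.C (z s(0, 0))) * pencilMinor d z +
      pencilRemainder d z := by
  rw [Matrix.det_succ_row_zero, Fin.sum_univ_succ, ← diagPencil_apply_self]
  simp only [Fin.val_zero, pow_zero, one_mul, Fin.val_succ, pencilMinor, pencilRemainder,
    ← submatrix_diagPencil]
  rfl

theorem natDegree_pencilRemainder_le (d : Fin (n + 2) → R) (z : Sym2 (Fin (n + 2)) → R) :
    (pencilRemainder d z).natDegree ≤ n := by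
  have hsign (k : ℕ) : ((-1 : Polynomial R) ^ k).natDegree = 0 := by
    rcases neg_one_pow_eq_or (Polynomial R) k with h | h <;> simp [h]
  have hconst {i j : Fin (n + 2)} (h : i ≠ j) : (diagPencil d z i j).natDegree = 0 := by
    rw [diagPencil_apply_ne _ _ h, Polynomial.natDegree_C]
  refine Polynomial.natDegree_sum_le_of_forall_le _ _ fun j _ => ?_
  refine Polynomial.natDegree_mul_le.trans ?_
  have h1 : ((-1) ^ ((j : ℕ) + 1) * diagPencil d z 0 j.succ).natDegree ≤ 0 :=
    Polynomial.natDegree_mul_le.trans (by rw [hsign, hconst (Fin.succ_ne_zero j).symm])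
  have h2 : ((diagPencil d z).submatrix Fin.succ j.succ.succAbove).det.natDegree ≤ n := by
    rw [Matrix.det_succ_column_zero]
    refine Polynomial.natDegree_sum_le_of_forall_le _ _ fun i _ => ?_
    refine Polynomial.natDegree_mul_le.trans ?_
    have h3 : ((-1) ^ (i : ℕ) * (diagPencil d z).submatrix Fin.succ j.succ.succAbove i 0).natDegree
        ≤ 0 := by
      refine Polynomial.natDegree_mul_le.trans ?_
      rw [hsign, Matrix.submatrix_apply, Fin.succ_succAbove_zero, hconst (Fin.succ_ne_zero i)]
    have h4 := natDegree_det_le (((diagPencil d z).submatrix Fin.succ j.succ.succAbove).submatrix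
      i.succAbove Fin.succ) 1 fun _ _ => natDegree_diagPencil_apply_le _ _ _ _
    rw [Fintype.card_fin] at h4
    omega
  omega

variable {d z} {z' : Sym2 (Fin (n + 1)) → R}

theorem diagPencil_apply_congr (h : ∀ e, e ≠ s(0, 0) → z e = z' e) {i j : Fin (n + 1)}
    (hij : i ≠ 0 ∨ j ≠ 0) : diagPencil d z i j = diagPencil d z' i j := by
  have hz : z s(i, j) = z' s(i, j) := h _ fun he => by
    have := Sym2.eq_iff.1 he
    tauto
  simp [diagPencil, matrixPencil, symmMatrix, hz]

theorem pencilMinor_congr (h : ∀ e, e ≠ s(0, 0) → z e = z' e) :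
    pencilMinor d z = pencilMinor d z' := by
  rw [pencilMinor, pencilMinor, ← submatrix_diagPencil, ← submatrix_diagPencil]
  congr 1
  ext1 i j
  exact diagPencil_apply_congr h (Or.inl (Fin.succ_ne_zero i))

theorem pencilRemainder_congr (h : ∀ e, e ≠ s(0, 0) → z e = z' e) :
    pencilRemainder d z = pencilRemainder d z' := by
  refine Finset.sum_congr rfl fun j _ => ?_
  rw [diagPencil_apply_congr h (Or.inr (Fin.succ_ne_zero j))]
  congr 2
  ext1 i k
  exact diagPencil_apply_congr h (Or.inl (Fin.succ_ne_zero i))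

end minor

/-- The resultant of `det (diagPencil d z)` and its lower right minor. -/
noncomputable def pencilResultant {R : Type*} [CommRing R] {n : ℕ} (d : Fin (n + 1) → R)
    (z : Sym2 (Fin (n + 1)) → R) : R :=
  Polynomial.resultant (diagPencil d z).det (pencilMinor d z) (n + 1) n

theorem map_pencilResultant {R S : Type*} [CommRing R] [CommRing S] (f : R →+* S) {n : ℕ}
    (d : Fin (n + 1) → R) (z : Sym2 (Fin (n + 1)) → R) :
    f (pencilResultant d z) = pencilResultant (f ∘ d) (f ∘ z) := by
  rw [pencilResultant, pencilResultant, ← Polynomial.resultant_map_map, pencilMinor, pencilMinor,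
    ← Polynomial.coe_mapRingHom, RingHom.map_det, RingHom.map_det, map_diagPencil, map_diagPencil]
  rfl

theorem pencilResultant_eq {R : Type*} [CommRing R] {n : ℕ} (d : Fin (n + 1) → R)
    (z : Sym2 (Fin (n + 1)) → R) : pencilResultant d z =
      Polynomial.resultant (pencilRemainder d z) (pencilMinor d z) (n + 1) n := by
  rw [pencilResultant, det_diagPencil_eq, add_comm, mul_comm]
  exact Polynomial.resultant_add_mul_left _ _ _ _ _
    (by have := Polynomial.natDegree_linear_le (a := d 0) (b := z s(0, 0)); omega)
    (natDegree_det_diagPencil_le _ _)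

theorem pencilResultant_congr {R : Type*} [CommRing R] {n : ℕ} {d : Fin (n + 1) → R}
    {z z' : Sym2 (Fin (n + 1)) → R} (h : ∀ e, e ≠ s(0, 0) → z e = z' e) :
    pencilResultant d z = pencilResultant d z' := by
  rw [pencilResultant_eq, pencilResultant_eq, pencilRemainder_congr h, pencilMinor_congr h]

/-- The polynomial in the entries of a symmetric matrix whose values are the resultants. -/
noncomputable def genericPencilResultant {n : ℕ} (d : Fin (n + 1) → ℤ) :
    MvPolynomial (Sym2 (Fin (n + 1))) ℤ :=
  pencilResultant (fun i => C (d i)) X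

theorem eval_genericPencilResultant {n : ℕ} (d : Fin (n + 1) → ℤ) (z : Sym2 (Fin (n + 1)) → ℤ) :
    eval z (genericPencilResultant d) = pencilResultant d z := by
  rw [genericPencilResultant, map_pencilResultant]
  congr 1
  · ext i; simp
  · ext e; simp

/-- The entries of the arrow matrix with diagonal `i * d i` and ones in the first row. -/
def arrowEntries {n : ℕ} (d : Fin (n + 1) → ℂ) : Sym2 (Fin (n + 1)) → ℂ :=
  Sym2.lift ⟨fun i j => if i = j then (i : ℕ) * d i else if i = 0 ∨ j = 0 then 1 else 0,
    fun i j => by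
      rcases eq_or_ne i j with rfl | h
      · rfl
      · simp [h, h.symm, or_comm]⟩

theorem pencilResultant_arrowEntries_ne_zero {n : ℕ} (d : Fin (n + 1) → ℂ) (hd : ∀ i, d i ≠ 0) :
    pencilResultant d (arrowEntries d) ≠ 0 := by
  have hF : (diagPencil d (arrowEntries d)).det.natDegree = n + 1 :=
    natDegree_det_diagPencil _ _ (Finset.prod_ne_zero_iff.2 fun i _ => hd i)
  have hb : (pencilMinor d (arrowEntries d)).natDegree = n :=
    natDegree_det_diagPencil _ _ (Finset.prod_ne_zero_iff.2 fun i _ => hd _)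
  have hcop : IsCoprime (diagPencil d (arrowEntries d)).det (pencilMinor d (arrowEntries d)) := by
    rw [Polynomial.isCoprime_iff_aeval_ne_zero_of_isAlgClosed ℂ ℂ]
    intro x
    by_contra! h
    simp only [Polynomial.coe_aeval_eq_eval] at h
    obtain ⟨hFx, hbx⟩ := h
    have hdiag : diagPencil (d ∘ Fin.succ) (arrowEntries d ∘ Sym2.map Fin.succ) =
        Matrix.diagonal fun i : Fin n => Polynomial.C (d i.succ) * Polynomial.X +
          Polynomial.C (((i : ℕ) + 1) * d i.succ) := by
      ext1 i j
      rcases eq_or_ne i j with rfl | hij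
      · simp [diagPencil_apply_self, arrowEntries]
      · simp [diagPencil_apply_ne _ _ hij, arrowEntries, hij]
    rw [pencilMinor, hdiag, Matrix.det_diagonal, Polynomial.eval_prod,
      Finset.prod_eq_zero_iff] at hbx
    obtain ⟨i, -, hi⟩ := hbx
    have hx : x = -((i : ℕ) + 1) := by
      have : d i.succ * (x + ((i : ℕ) + 1)) = 0 := by
        simp at hi
        linear_combination hi
      linear_combination (mul_eq_zero.1 this).resolve_left (hd _)
    rw [← Polynomial.coe_evalRingHom, RingHom.map_det] at hFx
    obtain ⟨v, hv0, hv⟩ := Matrix.exists_mulVec_eq_zero_iff.2 hFx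
    have hrow (k : Fin n) : v 0 + d k.succ * (x + ((k : ℕ) + 1)) * v k.succ = 0 := by
      have := congrFun hv k.succ
      rw [Matrix.mulVec, dotProduct, Fin.sum_univ_succ, Finset.sum_eq_single k] at this
      · simp [diagPencil_apply_self, diagPencil_apply_ne, arrowEntries] at this
        linear_combination this
      · intro j _ hj
        simp [diagPencil_apply_ne _ _ ((Fin.succ_injective n).ne hj.symm), arrowEntries, hj.symm]
      · simp
    have hv00 : v 0 = 0 := by simpa [hx] using hrow i
    have hvk (k : Fin n) (hk : k ≠ i) : v k.succ = 0 := by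
      have h1 := hrow k
      rw [hv00, zero_add, hx] at h1
      refine (mul_eq_zero.1 h1).resolve_left (mul_ne_zero (hd _) fun h2 => hk ?_)
      have h3 : ((k : ℕ) : ℂ) = (i : ℕ) := by linear_combination h2
      exact Fin.ext (by exact_mod_cast h3)
    have hvi : v i.succ = 0 := by
      have := congrFun hv 0
      rw [Matrix.mulVec, dotProduct, Fin.sum_univ_succ, Finset.sum_eq_single i] at this
      · simpa [hv00, diagPencil_apply_ne _ _ (Fin.succ_ne_zero i).symm, arrowEntries,
          (Fin.succ_ne_zero i).symm] using this
      · intro j _ hj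
        rw [hvk j hj, mul_zero]
      · simp
    refine hv0 (funext fun j => ?_)
    refine Fin.cases hv00 (fun k => ?_) j
    rcases eq_or_ne k i with rfl | hk
    · exact hvi
    · exact hvk k hk
  have := Polynomial.resultant_ne_zero _ _ hcop
  rwa [hF, hb] at this

theorem genericPencilResultant_ne_zero {n : ℕ} (d : Fin (n + 1) → ℤ) (hd : ∀ i, d i ≠ 0) :
    genericPencilResultant d ≠ 0 := by
  intro h
  have h1 := congrArg (eval₂Hom (Int.castRingHom ℂ) (arrowEntries fun i => (d i : ℂ))) h
  rw [genericPencilResultant, map_pencilResultant, map_zero] at h1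
  refine pencilResultant_arrowEntries_ne_zero (fun i => (d i : ℂ)) (by simpa using hd) ?_
  convert h1 using 2
  · ext i; exact (eval₂Hom_C (Int.castRingHom ℂ) (arrowEntries fun i => (d i : ℂ)) (d i)).symm
  · ext e; simp

theorem card_image_update_le {σ : Type*} [Fintype σ] [DecidableEq σ] {n : ℕ}
    (hn : Fintype.card σ = n + 1) (N : ℕ) (e : σ) (s : Finset (σ → ℤ))
    (hs : s ⊆ Fintype.piFinset fun _ => Finset.Icc (-(N : ℤ)) N) :
    (s.image fun z => Function.update z e 0).card ≤ (2 * N + 1) ^ n := by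
  have hsub : (s.image fun z => Function.update z e 0) ⊆ Fintype.piFinset
      (Function.update (fun _ => Finset.Icc (-(N : ℤ)) N) e {0}) := by
    intro w hw
    obtain ⟨z, hz, rfl⟩ := Finset.mem_image.1 hw
    refine Fintype.mem_piFinset.2 fun i => ?_
    rcases eq_or_ne i e with rfl | h
    · simp
    · simpa [h] using Fintype.mem_piFinset.1 (hs hz) i
  refine (Finset.card_le_card hsub).trans_eq ?_
  rw [Fintype.card_piFinset, Fintype.prod_eq_mul_prod_compl e]
  rw [Finset.prod_congr rfl (g := fun _ => 2 * N + 1), Finset.prod_const, Finset.card_compl, hn]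
  · simp
  · intro i hi
    rw [Function.update_of_ne (by simpa using hi), Int.card_Icc]
    omega

theorem card_fiber_le {d : Fin 5 → ℤ} (hd : ∀ i, d i ≠ 0) {z₀ : Sym2 (Fin 5) → ℤ}
    (hz₀ : pencilResultant d z₀ ≠ 0) (S : Finset (Sym2 (Fin 5) → ℤ))
    (hS : ∀ z ∈ S, (∀ e, e ≠ s(0, 0) → z e = z₀ e) ∧
      ∃ q, q ∣ (diagPencil d z).det ∧ (q.natDegree = 1 ∨ q.natDegree = 2)) :
    S.card ≤ 96 * ((pencilResultant d z₀).natAbs.divisors.card *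
      (∏ i, d i).natAbs.divisors.card) := by
  have hinj : Set.InjOn (fun z : Sym2 (Fin 5) → ℤ => z s(0, 0)) S := by
    intro z hz z' hz' h
    funext e
    rcases eq_or_ne e s(0, 0) with rfl | he
    · exact h
    · rw [(hS z hz).1 e he, (hS z' hz').1 e he]
  have hd' : ∏ i, (d ∘ Fin.succ) i ≠ 0 := Finset.prod_ne_zero_iff.2 fun i _ => hd _
  have hl : d 0 * (pencilMinor d z₀).leadingCoeff = ∏ i, d i := by
    rw [pencilMinor, leadingCoeff_det_diagPencil _ _ hd', Fin.prod_univ_succ]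
    rfl
  rw [← Finset.card_image_of_injOn hinj, ← hl]
  refine card_specializations_with_factor_le (b := pencilMinor d z₀) (r := pencilRemainder d z₀)
    (natDegree_det_diagPencil _ _ hd') (natDegree_pencilRemainder_le _ _) (hd 0) hz₀ _ fun t ht => ?_
  obtain ⟨z, hz, rfl⟩ := Finset.mem_image.1 ht
  obtain ⟨h, hq⟩ := hS z hz
  rw [← pencilMinor_congr h, ← pencilRemainder_congr h, ← det_diagPencil_eq,
    ← pencilResultant_congr h]
  exact ⟨rfl, hq⟩

theorem exists_card_divisors_eval_le {σ : Type*} [Fintype σ] (p : MvPolynomial σ ℤ) {δ : ℝ}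
    (hδ : 0 < δ) : ∃ K : ℝ, 0 < K ∧ ∀ N : ℕ, 1 ≤ N → ∀ z : σ → ℤ, (∀ i, |z i| ≤ N) →
      eval z p ≠ 0 → ((eval z p).natAbs.divisors.card : ℝ) ≤ K * (N : ℝ) ^ δ := by
  have hδ' : 0 < δ / (p.totalDegree + 1) := by positivity
  obtain ⟨K, hK, hdiv⟩ := exists_card_divisors_le_rpow _ hδ'
  obtain ⟨L, hL⟩ := exists_abs_eval_le p
  refine ⟨K * ((L : ℝ) ^ (δ / (p.totalDegree + 1)) + 1), by positivity, fun N hN z hz h0 => ?_⟩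
  have hN1 : (1 : ℝ) ≤ N := by exact_mod_cast hN
  have hR : ((eval z p).natAbs : ℝ) ≤ L * (N : ℝ) ^ p.totalDegree := by
    have := hL N hN z hz
    rw [Int.abs_eq_natAbs] at this
    exact_mod_cast this
  refine (hdiv _ (by simpa using h0)).trans ?_
  rw [mul_assoc]
  gcongr
  refine (Real.rpow_le_rpow (by positivity) hR hδ'.le).trans ?_
  rw [Real.mul_rpow (by positivity) (by positivity), ← Real.rpow_natCast, ← Real.rpow_mul
    (by positivity)]
  gcongr
  · linarith
  · rw [mul_div_assoc', div_le_iff₀ (by positivity)]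
    nlinarith

theorem card_sym2_fin_five : Fintype.card (Sym2 (Fin 5)) = 14 + 1 := by
  rw [Sym2.card]
  decide

theorem exists_card_diagPencil_with_factor_le {d : Fin 5 → ℤ} (hd : ∀ i, d i ≠ 0) {δ : ℝ}
    (hδ : 0 < δ) : ∃ K : ℝ, 0 < K ∧ ∀ N : ℕ, 1 ≤ N → ∀ S : Finset (Sym2 (Fin 5) → ℤ),
      (S ⊆ Fintype.piFinset fun _ => Finset.Icc (-(N : ℤ)) N) →
      (∀ z ∈ S, ∃ q, q ∣ (diagPencil d z).det ∧ (q.natDegree = 1 ∨ q.natDegree = 2)) →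
      (S.card : ℝ) ≤ K * ((N : ℝ) ^ 14 * (N : ℝ) ^ δ) := by
  obtain ⟨K, hK, hdiv⟩ := exists_card_divisors_eval_le (genericPencilResultant d) hδ
  obtain ⟨τ, hτ⟩ : ∃ τ, τ = (∏ i, d i).natAbs.divisors.card := ⟨_, rfl⟩
  obtain ⟨D, hD⟩ : ∃ D, D = (genericPencilResultant d).totalDegree := ⟨_, rfl⟩
  refine ⟨(D + 96 * (K * τ) + 1) * 3 ^ 14, by positivity, fun N hN S hSN hS => ?_⟩
  have hN1 : (1 : ℝ) ≤ N := by exact_mod_cast hN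
  have hNδ : 1 ≤ (N : ℝ) ^ δ := Real.one_le_rpow hN1 hδ.le
  generalize hE : (N : ℝ) ^ δ = E at hNδ
  have hbad : (S.filter fun z => eval z (genericPencilResultant d) = 0).card ≤
      D * (2 * N + 1) ^ 14 :=
    (Finset.card_le_card (Finset.filter_subset_filter _ hSN)).trans
      (hD ▸ exists_card_zeros_le (genericPencilResultant_ne_zero d hd) 14 card_sym2_fin_five N)
  have hgood : (S.filter fun z => ¬ eval z (genericPencilResultant d) = 0).card ≤
      ⌊96 * (K * E * τ)⌋₊ * (2 * N + 1) ^ 14 := by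
    refine (Finset.card_le_mul_card_image (f := fun z => Function.update z s(0, 0) 0) _ _
      fun a ha => ?_).trans (Nat.mul_le_mul_left _ (card_image_update_le
        card_sym2_fin_five N _ _
        ((Finset.filter_subset _ _).trans hSN)))
    obtain ⟨z₀, hz₀, rfl⟩ := Finset.mem_image.1 ha
    obtain ⟨hz₀S, hz₀⟩ := Finset.mem_filter.1 hz₀
    have hτR := hdiv N hN z₀ (fun i =>
      abs_le.2 (Finset.mem_Icc.1 (Fintype.mem_piFinset.1 (hSN hz₀S) i))) hz₀
    rw [eval_genericPencilResultant] at hz₀ hτR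
    refine (card_fiber_le hd hz₀ _ fun z hz => ?_).trans (Nat.le_floor ?_)
    · obtain ⟨hz, hzz⟩ := Finset.mem_filter.1 hz
      refine ⟨fun e he => ?_, hS z (Finset.mem_filter.1 hz).1⟩
      simpa [he] using congrFun hzz e
    · rw [← hτ, ← hE]
      push_cast
      gcongr
  rw [← Finset.card_filter_add_card_filter_not (s := S)
    fun z => eval z (genericPencilResultant d) = 0]
  generalize (S.filter fun z => eval z (genericPencilResultant d) = 0).card = m₀ at hbad ⊢
  generalize (S.filter fun z => ¬ eval z (genericPencilResultant d) = 0).card = m₁ at hgood ⊢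
  have h96 : 0 ≤ 96 * (K * E * τ) := by positivity
  generalize hB : ⌊96 * (K * E * τ)⌋₊ = B at hgood
  have hfloor : (B : ℝ) ≤ 96 * (K * E * τ) := hB ▸ Nat.floor_le h96
  have h3N : ((2 * N + 1 : ℕ) : ℝ) ^ 14 ≤ 3 ^ 14 * (N : ℝ) ^ 14 := by
    rw [← mul_pow]
    gcongr
    push_cast
    linarith
  have h1 : ((m₀ + m₁ : ℕ) : ℝ) ≤
      (D + B : ℝ) * ((2 * N + 1 : ℕ) : ℝ) ^ 14 := by
    rw [add_mul]
    push_cast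
    exact add_le_add (by exact_mod_cast hbad) (by exact_mod_cast hgood)
  have hW : 0 ≤ ((2 * N + 1 : ℕ) : ℝ) ^ 14 := pow_nonneg (Nat.cast_nonneg _) _
  generalize ((2 * N + 1 : ℕ) : ℝ) ^ 14 = W at h3N h1 hW
  generalize (N : ℝ) ^ 14 = V at h3N ⊢
  generalize (3 : ℝ) ^ 14 = T at h3N ⊢
  have hDE : (D : ℝ) ≤ D * E := le_mul_of_one_le_right (Nat.cast_nonneg D) hNδ
  have h2 : (D + B : ℝ) ≤ (D + 96 * (K * τ) + 1) * E := by
    linarith only [hDE, hfloor, hNδ]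
  have hD0 : 0 ≤ (D + 96 * (K * τ) + 1) * E :=
    (add_nonneg (Nat.cast_nonneg D) (Nat.cast_nonneg B)).trans h2
  refine (h1.trans (mul_le_mul h2 h3N hW hD0)).trans_eq ?_
  ring

/-- A nondegenerate symmetric integer matrix is diagonalized by an integer congruence. -/
theorem exists_transpose_mul_mul_eq_diagonal {n : ℕ} {A : Matrix (Fin n) (Fin n) ℤ}
    (hA : A.IsSymm) (hdet : A.det ≠ 0) :
    ∃ (M : Matrix (Fin n) (Fin n) ℤ) (d : Fin n → ℤ), M.det ≠ 0 ∧ (∀ i, d i ≠ 0) ∧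
      M.transpose * A * M = Matrix.diagonal d := by
  set A' : Matrix (Fin n) (Fin n) ℚ := A.map (Int.cast : ℤ → ℚ) with hA'
  have hsymm : (Matrix.toBilin' A').IsSymm := by
    rw [LinearMap.BilinForm.isSymm_iff_basis (Pi.basisFun ℚ (Fin n))]
    intro i j
    rw [Pi.basisFun_apply, Pi.basisFun_apply, Matrix.toBilin'_single, Matrix.toBilin'_single, hA',
      Matrix.map_apply, Matrix.map_apply, hA.apply]
  have : Invertible (2 : ℚ) := invertibleOfNonzero two_ne_zero
  obtain ⟨v₀, hv₀⟩ := LinearMap.BilinForm.exists_orthogonal_basis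
    (LinearMap.BilinForm.isSymm_iff.1 hsymm)
  have hfin : Module.finrank ℚ (Fin n → ℚ) = n := by simp
  set v := v₀.reindex (finCongr hfin) with hv
  have hvo (i j : Fin n) (hij : i ≠ j) : Matrix.toBilin' A' (v i) (v j) = 0 := by
    rw [hv, Module.Basis.reindex_apply, Module.Basis.reindex_apply]
    exact hv₀ ((finCongr hfin).symm.injective.ne hij)
  obtain ⟨k, hk⟩ := IsLocalization.exist_integer_multiples_of_finite (nonZeroDivisors ℤ)
    (fun e : Fin n × Fin n => v e.2 e.1)
  have hk0 : ((k : ℤ) : ℚ) ≠ 0 := by exact_mod_cast nonZeroDivisors.ne_zero k.2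
  choose f hf using hk
  let M : Matrix (Fin n) (Fin n) ℤ := Matrix.of fun i j => f (i, j)
  have hM : M.map (Int.cast : ℤ → ℚ) =
      ((k : ℤ) : ℚ) • (Matrix.of fun i j => v j i : Matrix (Fin n) (Fin n) ℚ) := by
    ext i j
    simpa [M] using hf (i, j)
  have hMdet : M.det ≠ 0 := by
    intro h
    have h1 : (M.map (Int.cast : ℤ → ℚ)).det = 0 := by
      have := (Int.castRingHom ℚ).map_det M
      rw [h, map_zero] at this
      exact this.symm
    have h2 : IsUnit (Matrix.of fun i j => v j i : Matrix (Fin n) (Fin n) ℚ) :=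
      Matrix.linearIndependent_cols_iff_isUnit.1 v.linearIndependent
    rw [hM, Matrix.det_smul] at h1
    exact mul_ne_zero (pow_ne_zero _ hk0) ((Matrix.isUnit_iff_isUnit_det _).1 h2).ne_zero h1
  have hdiag : M.transpose * A * M = Matrix.diagonal fun i => (M.transpose * A * M) i i := by
    ext i j
    rcases eq_or_ne i j with rfl | hij
    · simp
    · rw [Matrix.diagonal_apply_ne _ hij]
      have h1 : (M.transpose * A * M).map (Int.cast : ℤ → ℚ) =
          (M.map (Int.cast : ℤ → ℚ)).transpose * A' * M.map (Int.cast : ℤ → ℚ) := by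
        rw [← Matrix.transpose_map]
        exact ((Int.castRingHom ℚ).mapMatrix.map_mul _ _).trans
          (congrArg (· * _) ((Int.castRingHom ℚ).mapMatrix.map_mul _ _))
      have h2 := congrFun (congrFun h1 i) j
      have h3 := hvo i j hij
      rw [Matrix.toBilin'_apply', Matrix.dotProduct_mulVec] at h3
      rw [hM, Matrix.transpose_smul, Matrix.smul_mul, Matrix.smul_mul, Matrix.mul_smul,
        Matrix.smul_apply, Matrix.smul_apply, Matrix.mul_apply'] at h2
      change _ = _ • _ • (Matrix.vecMul (v i) A' ⬝ᵥ v j) at h2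
      rw [h3, smul_zero, smul_zero] at h2
      rw [Matrix.map_apply] at h2
      exact_mod_cast h2
  refine ⟨M, _, hMdet, fun i => ?_, hdiag⟩
  have h := congrArg Matrix.det hdiag
  rw [Matrix.det_mul, Matrix.det_mul, Matrix.det_transpose, Matrix.det_diagonal] at h
  have h0 := h ▸ mul_ne_zero (mul_ne_zero hMdet hdet) hMdet
  exact Finset.prod_ne_zero_iff.1 h0 i (Finset.mem_univ i)

theorem matrixPencil_congruence {n R : Type*} [Fintype n] [DecidableEq n] [CommRing R]
    (A B M : Matrix n n R) :
    (matrixPencil (M.transpose * A * M) (M.transpose * B * M)).det =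
      (matrixPencil A B).det * Polynomial.C M.det ^ 2 := by
  have h : matrixPencil (M.transpose * A * M) (M.transpose * B * M) =
      (M.map Polynomial.C).transpose * matrixPencil A B * M.map Polynomial.C := by
    simp only [matrixPencil, Matrix.map_mul, Matrix.transpose_map, mul_add, add_mul,
      Matrix.mul_smul, Matrix.smul_mul]
  have hdet : (M.map Polynomial.C).det = Polynomial.C M.det :=
    (RingHom.map_det Polynomial.C M).symm
  rw [h, Matrix.det_mul, Matrix.det_mul, Matrix.det_transpose, hdet]
  ring

theorem map_det_matrixPencil {n R S : Type*} [Fintype n] [DecidableEq n] [CommRing R]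
    [CommRing S] (f : R →+* S) (A B : Matrix n n R) :
    (matrixPencil A B).det.map f = (matrixPencil (A.map f) (B.map f)).det := by
  rw [← Polynomial.coe_mapRingHom, RingHom.map_det]
  congr 1
  ext1 i j
  simp [matrixPencil]

theorem aeval_charForm {S : Type*} [CommRing S] [Algebra ℚ S] (v : Fin 2 → S)
    (A B : Matrix (Fin 5) (Fin 5) ℤ) :
    aeval v (charForm A B) = (v 0 • A.map (Int.cast : ℤ → S) + v 1 • B.map (Int.cast : ℤ → S)).det := by
  rw [charForm, AlgHom.map_det]
  congr 1
  ext1 i j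
  simp

theorem aeval_charForm_one (A B : Matrix (Fin 5) (Fin 5) ℤ) :
    aeval ![(Polynomial.X : Polynomial ℚ), 1] (charForm A B) =
      (matrixPencil A B).det.map (Int.castRingHom ℚ) := by
  rw [aeval_charForm, map_det_matrixPencil]
  congr 1
  ext1 i j
  simp [matrixPencil]

theorem aeval_charForm_zero (A B : Matrix (Fin 5) (Fin 5) ℤ) :
    aeval ![(Polynomial.X : Polynomial ℚ), 0] (charForm A B) =
      Polynomial.X ^ 5 * Polynomial.C (A.det : ℚ) := by
  have h : (A.map (Int.cast : ℤ → Polynomial ℚ)).det = Polynomial.C (A.det : ℚ) := by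
    have := ((Int.castRingHom (Polynomial ℚ)).map_det A).symm
    simpa using this
  rw [aeval_charForm]
  simp [h]

theorem natDegree_aeval_le_of_isHomogeneous {g : MvPolynomial (Fin 2) ℚ} {k : ℕ}
    (hg : g.IsHomogeneous k) :
    (aeval ![(Polynomial.X : Polynomial ℚ), 1] g).natDegree ≤ k ∧
      aeval ![(Polynomial.X : Polynomial ℚ), 0] g =
        Polynomial.C ((aeval ![(Polynomial.X : Polynomial ℚ), 1] g).coeff k) *
          Polynomial.X ^ k := by
  have hdeg (s) (hs : s ∈ g.support) : s 0 + s 1 = k := by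
    have := hg (mem_support_iff.1 hs)
    rwa [Finsupp.weight_apply, Finsupp.sum_fintype _ _ (by simp), Fin.sum_univ_two, smul_eq_mul,
      smul_eq_mul, Pi.one_apply, Pi.one_apply, mul_one, mul_one] at this
  have h1 : aeval ![(Polynomial.X : Polynomial ℚ), 1] g =
      ∑ s ∈ g.support, Polynomial.C (g.coeff s) * Polynomial.X ^ s 0 := by
    rw [aeval_eq_eval₂Hom, coe_eval₂Hom, eval₂_eq']
    simp
  have h0 : aeval ![(Polynomial.X : Polynomial ℚ), 0] g =
      ∑ s ∈ g.support, Polynomial.C (g.coeff s) * (Polynomial.X ^ s 0 * 0 ^ s 1) := by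
    rw [aeval_eq_eval₂Hom, coe_eval₂Hom, eval₂_eq']
    simp
  refine ⟨?_, ?_⟩
  · rw [h1]
    refine Polynomial.natDegree_sum_le_of_forall_le _ _ fun s hs => ?_
    have := hdeg s hs
    exact (Polynomial.natDegree_C_mul_X_pow_le _ _).trans (by omega)
  · rw [h0, h1, Polynomial.finsetSum_coeff, map_sum, Finset.sum_mul]
    refine Finset.sum_congr rfl fun s hs => ?_
    have := hdeg s hs
    rcases Nat.eq_zero_or_pos (s 1) with h | h
    · have hk : s 0 = k := by omega
      simp [h, hk]
    · have hk : k ≠ s 0 := by omega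
      simp [h.ne', hk, Polynomial.coeff_X_pow]

/-- A rational zero or a quadratic factor of the characteristic form yields an integer factor
of degree one or two of the dehomogenized form. -/
theorem exists_factor_of_charForm {A B : Matrix (Fin 5) (Fin 5) ℤ} (hdet : A.det ≠ 0)
    (h : (∃ l m : ℚ, (l, m) ≠ (0, 0) ∧ MvPolynomial.eval ![l, m] (charForm A B) = 0) ∨
      (∃ g h : MvPolynomial (Fin 2) ℚ, charForm A B = g * h ∧ g.IsHomogeneous 2)) :
    ∃ q, q ∣ (matrixPencil A B).det ∧ (q.natDegree = 1 ∨ q.natDegree = 2) := by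
  have hdetQ : (A.det : ℚ) ≠ 0 := by exact_mod_cast hdet
  have hF : (matrixPencil A B).det ≠ 0 := by
    intro h0
    have := Polynomial.coeff_det_X_add_C_card A B
    rw [← matrixPencil, h0, Polynomial.coeff_zero] at this
    exact hdet this.symm
  suffices ∃ g : Polynomial ℚ, g ∣ (matrixPencil A B).det.map (Int.castRingHom ℚ) ∧
      (g.natDegree = 1 ∨ g.natDegree = 2) by
    obtain ⟨g, hg, hd⟩ := this
    obtain ⟨q, hq, hqd⟩ := exists_int_dvd_of_rat_dvd hF hg
    exact ⟨q, hq, hqd ▸ hd⟩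
  rcases h with ⟨l, m, hlm, h0⟩ | ⟨g, h, hgh, hg⟩
  · have h1 : (l • A.map (Int.cast : ℤ → ℚ) + m • B.map (Int.cast : ℤ → ℚ)).det = 0 := by
      have := aeval_charForm ![l, m] A B
      rw [← h0, ← coe_aeval_eq_eval]
      exact this.symm
    have hm : m ≠ 0 := by
      rintro rfl
      have hl : l ≠ 0 := by rintro rfl; exact hlm rfl
      rw [zero_smul, add_zero, Matrix.det_smul] at h1
      have h2 : (A.map (Int.cast : ℤ → ℚ)).det = A.det := ((Int.castRingHom ℚ).map_det A).symm
      rw [h2] at h1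
      exact mul_ne_zero (pow_ne_zero _ hl) hdetQ h1
    refine ⟨Polynomial.X - Polynomial.C (l / m), ?_, Or.inl (Polynomial.natDegree_X_sub_C _)⟩
    rw [Polynomial.dvd_iff_isRoot, Polynomial.IsRoot.def, map_det_matrixPencil,
      ← Polynomial.coe_evalRingHom, RingHom.map_det]
    have h2 : l • A.map (Int.cast : ℤ → ℚ) + m • B.map (Int.cast : ℤ → ℚ) =
        m • (Polynomial.evalRingHom (l / m)).mapMatrix
          (matrixPencil (A.map (Int.castRingHom ℚ)) (B.map (Int.castRingHom ℚ))) := by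
      ext1 i j
      simp [matrixPencil]
      field_simp
    rw [h2, Matrix.det_smul] at h1
    exact (mul_eq_zero.1 h1).resolve_left (pow_ne_zero _ hm)
  · obtain ⟨hle, hcoeff⟩ := natDegree_aeval_le_of_isHomogeneous hg
    refine ⟨aeval ![(Polynomial.X : Polynomial ℚ), 1] g, ?_, Or.inr ?_⟩
    · rw [← aeval_charForm_one, hgh, map_mul]
      exact dvd_mul_right _ _
    · refine Polynomial.natDegree_eq_of_le_of_coeff_ne_zero hle fun h2 => ?_
      have h3 := aeval_charForm_zero A B
      rw [hgh, map_mul, hcoeff, h2, map_zero, zero_mul, zero_mul] at h3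
      exact mul_ne_zero (pow_ne_zero _ Polynomial.X_ne_zero) (Polynomial.C_ne_zero.2 hdetQ) h3.symm

theorem abs_transpose_mul_mul_apply_le {n : ℕ} {M B : Matrix (Fin n) (Fin n) ℤ} {m : ℕ}
    (hM : ∀ i j, |M i j| ≤ m) {P : ℝ} (hB : ∀ i j, (|B i j| : ℝ) ≤ P) (i j : Fin n) :
    (|(M.transpose * B * M) i j| : ℝ) ≤ n * (n * (m * P * m)) := by
  have hM' (i j) : |(M i j : ℝ)| ≤ m := by exact_mod_cast hM i j
  have hsum (f : Fin n → ℝ) (c : ℝ) (hf : ∀ k, |f k| ≤ c) : |∑ k, f k| ≤ n * c := by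
    refine (Finset.abs_sum_le_sum_abs _ _).trans ((Finset.sum_le_card_nsmul _ _ c
      fun k _ => hf k).trans_eq ?_)
    simp
  simp only [Matrix.mul_apply, Matrix.transpose_apply, Finset.sum_mul]
  push_cast
  refine hsum _ _ fun k => hsum _ _ fun l => ?_
  have hP : 0 ≤ P := (abs_nonneg _).trans (hB l k)
  rw [abs_mul, abs_mul]
  exact mul_le_mul (mul_le_mul (hM' _ _) (hB _ _) (abs_nonneg _) (Nat.cast_nonneg _)) (hM' _ _)
    (abs_nonneg _) (by positivity)

theorem transpose_mul_mul_injective {n : ℕ} {M : Matrix (Fin n) (Fin n) ℤ} (hM : M.det ≠ 0) :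
    Function.Injective fun B : Matrix (Fin n) (Fin n) ℤ => M.transpose * B * M := by
  intro B B' h
  have hadj := congrArg (fun Y => M.adjugate.transpose * Y * M.adjugate) h
  have key (Y : Matrix (Fin n) (Fin n) ℤ) : M.adjugate.transpose * (M.transpose * Y * M) *
      M.adjugate = (M.det * M.det) • Y := by
    have h1 : M.adjugate.transpose * M.transpose = M.det • 1 := by
      rw [← Matrix.transpose_mul, Matrix.mul_adjugate, Matrix.transpose_smul, Matrix.transpose_one]
    rw [Matrix.mul_assoc, Matrix.mul_assoc, Matrix.mul_assoc, Matrix.mul_adjugate,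
      ← Matrix.mul_assoc, h1]
    rw [Matrix.smul_mul, Matrix.one_mul, Matrix.mul_smul, Matrix.mul_one, smul_smul]
  simp only [key] at hadj
  ext i j
  have := congrFun (congrFun hadj i) j
  simpa [hM] using this

/-- For a fixed symmetric integer `5×5` matrix `A` with `det A ≠ 0` and every `ε > 0`,
the number of symmetric integer matrices `B` with entries bounded by `P` such that
`f(λ,μ) = det(λA + μB)` has a nontrivial rational zero or splits off a homogeneous
factor of degree two over `ℚ` is `≪ P^(14 + 1/5 + ε)`. -/
theorem frequency_root_or_quadratic_factor (A : Matrix (Fin 5) (Fin 5) ℤ) (hA : A.IsSymm)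
    (hdet : A.det ≠ 0) :
    ∀ ε : ℝ, 0 < ε → ∃ C : ℝ, 0 < C ∧ ∀ P : ℝ, 1 ≤ P →
      (Nat.card {B : Matrix (Fin 5) (Fin 5) ℤ //
          B.IsSymm ∧ (∀ i j : Fin 5, (|B i j| : ℝ) ≤ P) ∧
          ((∃ l m : ℚ, (l, m) ≠ (0, 0) ∧ MvPolynomial.eval ![l, m] (charForm A B) = 0) ∨
            (∃ g h : MvPolynomial (Fin 2) ℚ, charForm A B = g * h ∧ g.IsHomogeneous 2))} : ℝ)
        ≤ C * P ^ ((14 : ℝ) + 1 / 5 + ε) := by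
  intro ε hε
  obtain ⟨M, d, hM, hd, hdiag⟩ := exists_transpose_mul_mul_eq_diagonal hA hdet
  obtain ⟨K, hK, hbound⟩ := exists_card_diagPencil_with_factor_le hd hε
  obtain ⟨m, hm1, hm⟩ : ∃ m : ℕ, 1 ≤ m ∧ ∀ i j, |M i j| ≤ m := by
    refine ⟨1 + ∑ i, ∑ j, (M i j).natAbs, by omega, fun i j => ?_⟩
    have h1 : (M i j).natAbs ≤ ∑ j, (M i j).natAbs :=
      Finset.single_le_sum (f := fun j => (M i j).natAbs) (fun _ _ => Nat.zero_le _)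
        (Finset.mem_univ j)
    have h2 : ∑ j, (M i j).natAbs ≤ ∑ i, ∑ j, (M i j).natAbs :=
      Finset.single_le_sum (f := fun i => ∑ j, (M i j).natAbs) (fun _ _ => Nat.zero_le _)
        (Finset.mem_univ i)
    rw [Int.abs_eq_natAbs]
    exact_mod_cast (h1.trans h2).trans (Nat.le_add_left _ _)
  have hm1' : (1 : ℝ) ≤ m := by exact_mod_cast hm1
  obtain ⟨c, hc⟩ : ∃ c : ℝ, c = 25 * (m * m) := ⟨_, rfl⟩
  have hc1 : 1 ≤ c := by nlinarith
  refine ⟨K * c ^ (14 + ε), by positivity, fun P hP => ?_⟩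
  have hcP : 1 ≤ c * P := by nlinarith
  obtain ⟨N, hN⟩ : ∃ N, N = ⌊c * P⌋₊ := ⟨_, rfl⟩
  have hN1 : 1 ≤ N := hN ▸ Nat.le_floor (by exact_mod_cast hcP)
  have hNle : (N : ℝ) ≤ c * P := hN ▸ Nat.floor_le (by positivity)
  classical
  let S : Finset (Sym2 (Fin 5) → ℤ) :=
    (Fintype.piFinset fun _ => Finset.Icc (-(N : ℤ)) N).filter fun z =>
      ∃ q, q ∣ (diagPencil d z).det ∧ (q.natDegree = 1 ∨ q.natDegree = 2)
  have hS := hbound N hN1 S (Finset.filter_subset _ _) fun z hz => (Finset.mem_filter.1 hz).2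
  have hsymm (B : Matrix (Fin 5) (Fin 5) ℤ) (hB : B.IsSymm) (i j : Fin 5) :
      (M.transpose * B * M) i j = (M.transpose * B * M) j i := by
    rw [← Matrix.transpose_apply (M.transpose * B * M), Matrix.transpose_mul, Matrix.transpose_mul,
      Matrix.transpose_transpose, hB.eq, Matrix.mul_assoc]
  have hcard : Nat.card {B : Matrix (Fin 5) (Fin 5) ℤ //
      B.IsSymm ∧ (∀ i j : Fin 5, (|B i j| : ℝ) ≤ P) ∧
      ((∃ l m : ℚ, (l, m) ≠ (0, 0) ∧ MvPolynomial.eval ![l, m] (charForm A B) = 0) ∨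
        (∃ g h : MvPolynomial (Fin 2) ℚ, charForm A B = g * h ∧ g.IsHomogeneous 2))} ≤
      S.card := by
    rw [← Nat.card_eq_finsetCard S]
    refine Nat.card_le_card_of_injective (fun B => ⟨Sym2.lift ⟨fun i j =>
      (M.transpose * B.1 * M) i j, hsymm B.1 B.2.1⟩, ?_⟩) fun B B' h => ?_
    · refine Finset.mem_filter.2 ⟨Fintype.mem_piFinset.2 fun e => ?_, ?_⟩
      · induction e with | _ i j
        rw [Finset.mem_Icc, ← abs_le, Sym2.lift_mk, Int.abs_eq_natAbs, Nat.cast_le, hN]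
        refine Nat.le_floor ?_
        have := abs_transpose_mul_mul_apply_le hm B.2.2.1 i j
        rw [← Int.cast_abs, Int.abs_eq_natAbs, Int.cast_natCast] at this
        refine this.trans_eq ?_
        rw [hc]
        push_cast
        ring
      · obtain ⟨q, hq, hqd⟩ := exists_factor_of_charForm hdet B.2.2.2
        refine ⟨q, ?_, hqd⟩
        have h1 := matrixPencil_congruence A B.1 M
        rw [hdiag] at h1
        exact (hq.trans (dvd_mul_right _ _)).trans (dvd_of_eq h1.symm)
    · refine Subtype.ext (transpose_mul_mul_injective hM ?_)
      ext i j
      exact congrFun (congrArg Subtype.val h) s(i, j)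
  have hP0 : 0 < P := by linarith
  have hN0 : (0 : ℝ) < N := by exact_mod_cast hN1
  calc _ ≤ (S.card : ℝ) := by exact_mod_cast hcard
    _ ≤ K * (N : ℝ) ^ (14 + ε) := by
      rw [Real.rpow_add hN0]
      exact_mod_cast hS
    _ ≤ K * (c * P) ^ (14 + ε) := by gcongr
    _ = K * c ^ (14 + ε) * P ^ (14 + ε) := by
      rw [Real.mul_rpow (by positivity) hP0.le, mul_assoc]
    _ ≤ _ := by
      gcongr
      norm_num
end

section
/- Let A be a fixed symmetric 5×5 matrix with integer entries and det(A) ≠ 0. For every ε > 0 there is a constant C (depending only on ε and A) such that for all P ≥ 1, the number of symmetric 5×5 integer matrices B = (b_ij) with |b_ij| ≤ P for all 1 ≤ i ≤ j ≤ 5, for which the homogeneous polynomial f(λ,μ) = det(λA + μB) has a nontrivial rational zero (λ,μ) ∈ ℚ² \ {(0,0)}, is at most C · P^{14 + 1/5 + ε}. -/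
open MvPolynomial

/-- The symmetric `5 × 5` matrix whose entries on and above the diagonal, row by row, are `v`. -/
def symmOfUpper (v : Fin 15 → ℤ) : Matrix (Fin 5) (Fin 5) ℤ :=
  !![v 0, v 1, v 2, v 3, v 4;
     v 1, v 5, v 6, v 7, v 8;
     v 2, v 6, v 9, v 10, v 11;
     v 3, v 7, v 10, v 12, v 13;
     v 4, v 8, v 11, v 13, v 14]

/-- The determinant of the lower right `3 × 3` block of `symmOfUpper v`. -/
def blockDet (v : Fin 15 → ℤ) : ℤ :=
  v 9 * v 12 * v 14 + 2 * v 10 * v 11 * v 13 - v 9 * v 13 ^ 2 - v 10 ^ 2 * v 14 - v 11 ^ 2 * v 12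

/-- The bilinear form given by the adjugate of the lower right `3 × 3` block of `symmOfUpper v`. -/
def adjForm (v : Fin 15 → ℤ) (x₁ x₂ x₃ y₁ y₂ y₃ : ℤ) : ℤ :=
  (v 12 * v 14 - v 13 ^ 2) * (x₁ * y₁) + (v 9 * v 14 - v 11 ^ 2) * (x₂ * y₂)
    + (v 9 * v 12 - v 10 ^ 2) * (x₃ * y₃)
    + (v 11 * v 13 - v 10 * v 14) * (x₁ * y₂ + x₂ * y₁)
    + (v 10 * v 13 - v 11 * v 12) * (x₁ * y₃ + x₃ * y₁)
    + (v 10 * v 11 - v 9 * v 13) * (x₂ * y₃ + x₃ * y₂)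

/-- The principal minor of `symmOfUpper v` deleting index `1`. -/
def minorDeleteOne (v : Fin 15 → ℤ) : ℤ :=
  blockDet v * v 0 - adjForm v (v 2) (v 3) (v 4) (v 2) (v 3) (v 4)

/-- The principal minor of `symmOfUpper v` deleting index `0`. -/
def minorDeleteZero (v : Fin 15 → ℤ) : ℤ :=
  blockDet v * v 5 - adjForm v (v 6) (v 7) (v 8) (v 6) (v 7) (v 8)

/-- The minor of `symmOfUpper v` deleting row `0` and column `1`. -/
def minorMixed (v : Fin 15 → ℤ) : ℤ :=
  blockDet v * v 1 - adjForm v (v 2) (v 3) (v 4) (v 6) (v 7) (v 8)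

theorem blockDet_mul_det (v : Fin 15 → ℤ) :
    blockDet v * (symmOfUpper v).det
      = minorDeleteOne v * minorDeleteZero v - minorMixed v ^ 2 := by
  have h : (symmOfUpper v).det = blockDet v * (v 0 * v 5 - v 1 ^ 2)
      - adjForm v (v 6) (v 7) (v 8) (v 6) (v 7) (v 8) * v 0
      - adjForm v (v 2) (v 3) (v 4) (v 2) (v 3) (v 4) * v 5
      + 2 * adjForm v (v 2) (v 3) (v 4) (v 6) (v 7) (v 8) * v 1
      + (v 9 * (v 3 * v 8 - v 4 * v 7) ^ 2 + v 12 * (v 4 * v 6 - v 2 * v 8) ^ 2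
        + v 14 * (v 2 * v 7 - v 3 * v 6) ^ 2
        + 2 * v 10 * (v 3 * v 8 - v 4 * v 7) * (v 4 * v 6 - v 2 * v 8)
        + 2 * v 11 * (v 3 * v 8 - v 4 * v 7) * (v 2 * v 7 - v 3 * v 6)
        + 2 * v 13 * (v 4 * v 6 - v 2 * v 8) * (v 2 * v 7 - v 3 * v 6)) := by
    simp [symmOfUpper, Matrix.det_succ_row_zero, Fin.sum_univ_succ, Fin.succAbove, blockDet,
      adjForm]
    ring
  rw [h]
  simp only [minorDeleteOne, minorDeleteZero, minorMixed, blockDet, adjForm]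
  ring

theorem abs_minorMixed_le {v : Fin 15 → ℤ} {N : ℕ} (hv : ∀ k, |v k| ≤ N) :
    |minorMixed v| ≤ 24 * (N : ℤ) ^ 4 := by
  have h : minorMixed v = Matrix.det !![v 1, v 2, v 3, v 4; v 6, v 9, v 10, v 11;
      v 7, v 10, v 12, v 13; v 8, v 11, v 13, v 14] := by
    simp [Matrix.det_succ_row_zero, Fin.sum_univ_succ, Fin.succAbove, blockDet, adjForm, minorMixed]
    ring
  rw [h]
  have := Matrix.det_le (A := !![v 1, v 2, v 3, v 4; v 6, v 9, v 10, v 11;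
      v 7, v 10, v 12, v 13; v 8, v 11, v 13, v 14]) (abv := AbsoluteValue.abs) (x := (N : ℤ)) (by
      intro i j
      fin_cases i <;> fin_cases j <;> simp [hv])
  simpa [Nat.factorial] using this

theorem card_le_of_card_fiber_le {ι : Type*} [Fintype ι] [DecidableEq ι] {n : ℕ}
    (hn : Fintype.card ι = n + 2) {i j : ι} (hij : i ≠ j) {N c : ℕ}
    {S : Finset (ι → ℤ)} (hS : ∀ v ∈ S, ∀ k, |v k| ≤ N)
    (h : ∀ w ∈ S, ∃ T : Finset (ℤ × ℤ), T.card ≤ c ∧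
      ∀ x y, Function.update (Function.update w i x) j y ∈ S → (x, y) ∈ T) :
    S.card ≤ c * (2 * N + 1) ^ n := by
  classical
  let f : (ι → ℤ) → ({k : ι // k ∉ ({i, j} : Finset ι)} → ℤ) := fun v k => v k
  let t : Finset ({k : ι // k ∉ ({i, j} : Finset ι)} → ℤ) :=
    Fintype.piFinset fun _ => Finset.Icc (-(N : ℤ)) N
  have ht : t.card = (2 * N + 1) ^ n := by
    have h1 : (Finset.Icc (-(N : ℤ)) N).card = 2 * N + 1 := by
      rw [Int.card_Icc]; omega
    have h2 : Fintype.card {k : ι // k ∉ ({i, j} : Finset ι)} = n := by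
      rw [← Nat.add_sub_cancel (n := n) (m := 2), ← hn]
      rw [Fintype.card_subtype, ← Finset.card_pair hij, ← Finset.card_compl]
      congr 1
      ext k
      simp
    simp only [t]
    rw [Fintype.card_piFinset, Finset.prod_const, Finset.card_univ, h1, h2]
  rw [← ht]
  refine Finset.card_le_mul_card_image_of_maps_to (f := f) ?_ c ?_
  · intro v hv
    simp only [t, f, Fintype.mem_piFinset, Finset.mem_Icc]
    exact fun k => abs_le.1 (hS v hv k)
  · intro b _
    rcases Finset.eq_empty_or_nonempty {v ∈ S | f v = b} with he | ⟨w, hw⟩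
    · simp [he]
    · rw [Finset.mem_filter] at hw
      obtain ⟨T, hT, hmem⟩ := h w hw.1
      have key : ∀ v ∈ ({v ∈ S | f v = b} : Finset (ι → ℤ)),
          v = Function.update (Function.update w i (v i)) j (v j) := by
        intro v hv
        rw [Finset.mem_filter] at hv
        ext k
        by_cases hj : k = j
        · subst hj; simp
        by_cases hi : k = i
        · subst hi; simp [hj]
        · simpa [hi, hj, f] using congrFun (hv.2.trans hw.2.symm) ⟨k, by simp [hi, hj]⟩
      refine (Finset.card_le_card_of_injOn (fun v => (v i, v j)) ?_ ?_).trans hT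
      · intro v hv
        refine hmem _ _ ?_
        rw [← key v hv]
        exact (Finset.mem_filter.1 hv).1
      · intro v hv v' hv' hvv
        simp only [Prod.mk.injEq] at hvv
        rw [key v hv, key v' hv', hvv.1, hvv.2]

theorem exists_finset_card_le_two_of_quadratic {a : ℤ} (ha : a ≠ 0) (b c : ℤ) :
    ∃ T : Finset ℤ, T.card ≤ 2 ∧ ∀ x, a * x ^ 2 + b * x + c = 0 → x ∈ T := by
  by_cases h : ∃ r, a * r ^ 2 + b * r + c = 0
  · obtain ⟨r, hr⟩ := h
    refine ⟨{r, (-b - a * r) / a}, Finset.card_le_two, fun x hx => ?_⟩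
    rw [Finset.mem_insert, Finset.mem_singleton]
    have : (x - r) * (a * (x + r) + b) = 0 := by linear_combination hx - hr
    rcases mul_eq_zero.1 this with h | h
    · exact Or.inl (by linarith)
    · right
      rw [show -b - a * r = a * x by linarith, Int.mul_ediv_cancel_left _ ha]
  · push Not at h
    exact ⟨∅, by simp, fun x hx => absurd hx (h x)⟩

theorem exists_finset_mul_eq {α D : ℤ} (hα : α ≠ 0) (hD : D ≠ 0) (β γ : ℤ) :
    ∃ T : Finset (ℤ × ℤ), T.card ≤ 2 * D.natAbs.divisors.card ∧
      ∀ x y, (α * x - γ) * (α * y - β) = D → (x, y) ∈ T := by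
  classical
  let g : ℤ → ℤ × ℤ := fun d => ((d + γ) / α, (D / d + β) / α)
  refine ⟨(D.natAbs.divisors.image fun d : ℕ => g d) ∪ D.natAbs.divisors.image fun d : ℕ => g (-d),
    ?_, fun x y hxy => ?_⟩
  · have h1 := Finset.card_image_le (s := D.natAbs.divisors) (f := fun d : ℕ => g d)
    have h2 := Finset.card_image_le (s := D.natAbs.divisors) (f := fun d : ℕ => g (-d))
    refine (Finset.card_union_le _ _).trans (by omega)
  · have hg : g (α * x - γ) = (x, y) := by
      have hne : α * x - γ ≠ 0 := left_ne_zero_of_mul (hxy ▸ hD)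
      simp only [g, ← hxy, Int.mul_ediv_cancel_left _ hne, sub_add_cancel,
        Int.mul_ediv_cancel_left _ hα]
    have hdvd : (α * x - γ).natAbs ∈ D.natAbs.divisors :=
      Nat.mem_divisors.2 ⟨Int.natAbs_dvd_natAbs.2 ⟨_, hxy.symm⟩, Int.natAbs_ne_zero.2 hD⟩
    rw [Finset.mem_union, Finset.mem_image, Finset.mem_image, ← hg]
    rcases Int.natAbs_eq (α * x - γ) with h | h
    · exact Or.inl ⟨_, hdvd, by rw [← h]⟩
    · exact Or.inr ⟨_, hdvd, by rw [← h]⟩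

theorem exists_succ_pow_le_mul_two_pow (k : ℕ) :
    ∃ C : ℕ, 1 ≤ C ∧ ∀ e : ℕ, (e + 1) ^ k ≤ C * 2 ^ e := by
  have h :=
    (tendsto_pow_const_div_const_pow_of_one_lt k (r := (2 : ℝ)) (by norm_num)).bddAbove_range
  obtain ⟨M, hM⟩ := h
  refine ⟨2 * ⌈M⌉₊ + 1, by omega, fun e => ?_⟩
  have h1 : ((e + 1 : ℕ) : ℝ) ^ k / 2 ^ (e + 1) ≤ M := hM ⟨e + 1, rfl⟩
  rw [div_le_iff₀ (by positivity)] at h1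
  have h2 : M ≤ ⌈M⌉₊ := Nat.le_ceil M
  have h3 : ((e + 1 : ℕ) : ℝ) ^ k ≤ (2 * ⌈M⌉₊ + 1) * 2 ^ e := by
    have : (0 : ℝ) < 2 ^ e := by positivity
    calc _ ≤ M * 2 ^ (e + 1) := h1
      _ = 2 * M * 2 ^ e := by ring
      _ ≤ _ := by gcongr; linarith
  exact_mod_cast h3

theorem exists_card_divisors_pow_le (k : ℕ) :
    ∃ C : ℕ, 1 ≤ C ∧ ∀ n : ℕ, n ≠ 0 → n.divisors.card ^ k ≤ C * n := by
  obtain ⟨C, hC, h⟩ := exists_succ_pow_le_mul_two_pow k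
  refine ⟨C ^ 2 ^ k, Nat.one_le_pow _ _ hC, fun n hn => ?_⟩
  rw [Nat.card_divisors hn, ← Finset.prod_pow]
  have hterm : ∀ p ∈ n.primeFactors, (n.factorization p + 1) ^ k
      ≤ (if p < 2 ^ k then C else 1) * p ^ n.factorization p := by
    intro p hp
    have hp2 := (Nat.prime_of_mem_primeFactors hp).two_le
    split_ifs with hlt
    · exact (h _).trans (by gcongr)
    · rw [one_mul]
      calc (n.factorization p + 1) ^ k ≤ (2 ^ n.factorization p) ^ k := by
            gcongr; exact Nat.lt_two_pow_self
        _ = (2 ^ k) ^ n.factorization p := by rw [← pow_mul, ← pow_mul, mul_comm]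
        _ ≤ _ := by gcongr; omega
  refine (Finset.prod_le_prod' hterm).trans ?_
  rw [Finset.prod_mul_distrib]
  refine Nat.mul_le_mul ?_ (Nat.prod_factorization_pow_eq_self hn).le
  rw [Finset.prod_ite, Finset.prod_const, Finset.prod_const_one, mul_one]
  refine Nat.pow_le_pow_right hC ?_
  calc _ ≤ (Finset.range (2 ^ k)).card := Finset.card_le_card (by
        intro p hp; simpa using (Finset.mem_filter.1 hp).2)
    _ = _ := by simp

theorem det_symmOfUpper_update_zero (v : Fin 15 → ℤ) (x : ℤ) :
    (symmOfUpper (Function.update v 0 x)).det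
      = (symmOfUpper v).det + minorDeleteZero v * (x - v 0) := by
  simp [symmOfUpper, Matrix.det_succ_row_zero, Fin.sum_univ_succ, Fin.succAbove, blockDet, adjForm,
    minorDeleteZero]
  ring

section CardBounds

variable {N : ℕ} {S : Finset (Fin 15 → ℤ)}

theorem card_le_of_blockDet_ne_zero_of_minorMixed_ne_zero {c : ℕ}
    (hS : ∀ v ∈ S, ∀ k, |v k| ≤ N)
    (hc : ∀ v ∈ S, 2 * (minorMixed v ^ 2).natAbs.divisors.card ≤ c)
    (h : ∀ v ∈ S, (symmOfUpper v).det = 0 ∧ blockDet v ≠ 0 ∧ minorMixed v ≠ 0) :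
    S.card ≤ c * (2 * N + 1) ^ 13 := by
  refine card_le_of_card_fiber_le (Fintype.card_fin 15) (i := 0) (j := 5) (by decide) hS
    fun w hw => ?_
  obtain ⟨-, hα, hκ⟩ := h w hw
  obtain ⟨T, hT, hmem⟩ := exists_finset_mul_eq hα (pow_ne_zero 2 hκ)
    (adjForm w (w 6) (w 7) (w 8) (w 6) (w 7) (w 8)) (adjForm w (w 2) (w 3) (w 4) (w 2) (w 3) (w 4))
  refine ⟨T, hT.trans (hc w hw), fun x y hxy => hmem x y ?_⟩
  have hdet := blockDet_mul_det (Function.update (Function.update w 0 x) 5 y)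
  rw [(h _ hxy).1] at hdet
  simp [blockDet, adjForm, minorMixed, minorDeleteOne, minorDeleteZero] at hdet ⊢
  linear_combination -hdet

theorem card_le_of_minorDeleteOne_eq_zero (hS : ∀ v ∈ S, ∀ k, |v k| ≤ N)
    (h : ∀ v ∈ S, blockDet v ≠ 0 ∧ minorMixed v = 0 ∧ minorDeleteOne v = 0) :
    S.card ≤ 1 * (2 * N + 1) ^ 13 := by
  refine card_le_of_card_fiber_le (Fintype.card_fin 15) (i := 0) (j := 1) (by decide) hS
    fun w hw => ?_
  refine ⟨{(w 0, w 1)}, by simp, fun x y hxy => ?_⟩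
  obtain ⟨hα, h1, h2⟩ := h w hw
  obtain ⟨-, h3, h4⟩ := h _ hxy
  have e1 : blockDet w * (y - w 1) = 0 := by
    simp [blockDet, adjForm, minorMixed] at h1 h3
    rw [blockDet]
    linear_combination h3 - h1
  have e2 : blockDet w * (x - w 0) = 0 := by
    simp [blockDet, adjForm, minorDeleteOne] at h2 h4
    rw [blockDet]
    linear_combination h4 - h2
  simp only [mul_eq_zero, hα, false_or, sub_eq_zero] at e1 e2
  simp [e1, e2]

theorem card_le_of_minorDeleteZero_eq_zero (hS : ∀ v ∈ S, ∀ k, |v k| ≤ N)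
    (h : ∀ v ∈ S, blockDet v ≠ 0 ∧ minorMixed v = 0 ∧ minorDeleteZero v = 0) :
    S.card ≤ 1 * (2 * N + 1) ^ 13 := by
  refine card_le_of_card_fiber_le (Fintype.card_fin 15) (i := 5) (j := 1) (by decide) hS
    fun w hw => ?_
  refine ⟨{(w 5, w 1)}, by simp, fun x y hxy => ?_⟩
  obtain ⟨hα, h1, h2⟩ := h w hw
  obtain ⟨-, h3, h4⟩ := h _ hxy
  have e1 : blockDet w * (y - w 1) = 0 := by
    simp [blockDet, adjForm, minorMixed] at h1 h3
    rw [blockDet]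
    linear_combination h3 - h1
  have e2 : blockDet w * (x - w 5) = 0 := by
    simp [blockDet, adjForm, minorDeleteZero] at h2 h4
    rw [blockDet]
    linear_combination h4 - h2
  simp only [mul_eq_zero, hα, false_or, sub_eq_zero] at e1 e2
  simp [e1, e2]

theorem card_le_of_blockDet_eq_zero_of_minorDeleteZero_ne_zero (hS : ∀ v ∈ S, ∀ k, |v k| ≤ N)
    (h : ∀ v ∈ S, (symmOfUpper v).det = 0 ∧ blockDet v = 0 ∧ v 9 * v 12 - v 10 ^ 2 ≠ 0 ∧
      minorDeleteZero v ≠ 0) :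
    S.card ≤ 1 * (2 * N + 1) ^ 13 := by
  refine card_le_of_card_fiber_le (Fintype.card_fin 15) (i := 14) (j := 0) (by decide) hS
    fun w hw => ?_
  refine ⟨{(w 14, w 0)}, by simp, fun x y hxy => ?_⟩
  obtain ⟨h1, h2, hq, hβ⟩ := h w hw
  obtain ⟨h3, h4, -, -⟩ := h _ hxy
  have e1 : (w 9 * w 12 - w 10 ^ 2) * (x - w 14) = 0 := by
    simp [blockDet] at h2 h4
    linear_combination h4 - h2
  simp only [mul_eq_zero, hq, false_or, sub_eq_zero] at e1
  subst e1
  rw [Function.update_eq_self, det_symmOfUpper_update_zero, h1] at h3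
  simp only [zero_add, mul_eq_zero, hβ, false_or, sub_eq_zero] at h3
  simp [h3]

theorem card_le_of_blockDet_eq_zero_of_minorDeleteZero_eq_zero (hS : ∀ v ∈ S, ∀ k, |v k| ≤ N)
    (h : ∀ v ∈ S, blockDet v = 0 ∧ v 9 * v 12 - v 10 ^ 2 ≠ 0 ∧ minorDeleteZero v = 0) :
    S.card ≤ 2 * (2 * N + 1) ^ 13 := by
  refine card_le_of_card_fiber_le (Fintype.card_fin 15) (i := 14) (j := 8) (by decide) hS
    fun w hw => ?_
  obtain ⟨h2, hq, -⟩ := h w hw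
  obtain ⟨T, hT, hmem⟩ := exists_finset_card_le_two_of_quadratic hq
    (2 * ((w 10 * w 13 - w 11 * w 12) * w 6 + (w 10 * w 11 - w 9 * w 13) * w 7))
    ((w 12 * w 14 - w 13 ^ 2) * w 6 ^ 2 + (w 9 * w 14 - w 11 ^ 2) * w 7 ^ 2
      + 2 * (w 11 * w 13 - w 10 * w 14) * w 6 * w 7)
  refine ⟨{w 14} ×ˢ T, by simpa using hT, fun x y hxy => ?_⟩
  obtain ⟨h4, -, h5⟩ := h _ hxy
  have e1 : (w 9 * w 12 - w 10 ^ 2) * (x - w 14) = 0 := by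
    simp [blockDet] at h2 h4
    linear_combination h4 - h2
  simp only [mul_eq_zero, hq, false_or, sub_eq_zero] at e1
  subst e1
  rw [minorDeleteZero, h4, Function.update_eq_self] at h5
  refine Finset.mk_mem_product (by simp) (hmem y ?_)
  simp [adjForm] at h5
  linear_combination -h5

theorem card_le_of_minor_eq_zero_of_entry_ne_zero (hS : ∀ v ∈ S, ∀ k, |v k| ≤ N)
    (h : ∀ v ∈ S, blockDet v = 0 ∧ v 9 * v 12 - v 10 ^ 2 = 0 ∧ v 12 ≠ 0) :
    S.card ≤ 2 * (2 * N + 1) ^ 13 := by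
  refine card_le_of_card_fiber_le (Fintype.card_fin 15) (i := 9) (j := 11) (by decide) hS
    fun w hw => ?_
  obtain ⟨-, hq, h12⟩ := h w hw
  obtain ⟨T, hT, hmem⟩ := exists_finset_card_le_two_of_quadratic h12
    (-2 * w 10 * w 13) (w 9 * w 13 ^ 2)
  refine ⟨{w 9} ×ˢ T, by simpa using hT, fun x y hxy => ?_⟩
  obtain ⟨h4, h5, -⟩ := h _ hxy
  have e1 : w 12 * (x - w 9) = 0 := by
    simp at h5
    linear_combination h5 - hq
  simp only [mul_eq_zero, h12, false_or, sub_eq_zero] at e1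
  subst e1
  rw [Function.update_eq_self] at h4
  refine Finset.mk_mem_product (by simp) (hmem y ?_)
  simp [blockDet] at h4
  linear_combination w 14 * hq - h4

theorem card_le_of_minor_eq_zero_of_entry_eq_zero (hS : ∀ v ∈ S, ∀ k, |v k| ≤ N)
    (h : ∀ v ∈ S, v 9 * v 12 - v 10 ^ 2 = 0 ∧ v 12 = 0) :
    S.card ≤ 1 * (2 * N + 1) ^ 13 := by
  refine card_le_of_card_fiber_le (Fintype.card_fin 15) (i := 10) (j := 12) (by decide) hS
    fun w hw => ?_
  refine ⟨{(0, 0)}, by simp, fun x y hxy => ?_⟩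
  obtain ⟨h1, h2⟩ := h _ hxy
  rw [h2] at h1
  simp at h1 h2
  simp [h1, h2]

/-- A set of singular symmetric `5 × 5` matrices with entries at most `N` has size
`O((c + 1) N ^ 13)`, where `c` bounds twice the number of divisors of `minorMixed v ^ 2`. -/
theorem card_le_of_det_symmOfUpper_eq_zero {c : ℕ} (hS : ∀ v ∈ S, ∀ k, |v k| ≤ N)
    (hc : ∀ v ∈ S, minorMixed v ≠ 0 → 2 * (minorMixed v ^ 2).natAbs.divisors.card ≤ c)
    (h : ∀ v ∈ S, (symmOfUpper v).det = 0) :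
    S.card ≤ (c + 8) * (2 * N + 1) ^ 13 := by
  have hmem : ∀ (p : (Fin 15 → ℤ) → Prop) [DecidablePred p], ∀ v ∈ S.filter p, ∀ k, |v k| ≤ N :=
    fun p _ v hv => hS v (Finset.mem_filter.1 hv).1
  have hcover : S ⊆ {v ∈ S | blockDet v ≠ 0 ∧ minorMixed v ≠ 0} ∪
      ({v ∈ S | blockDet v ≠ 0 ∧ minorMixed v = 0 ∧ minorDeleteOne v = 0} ∪
      ({v ∈ S | blockDet v ≠ 0 ∧ minorMixed v = 0 ∧ minorDeleteZero v = 0} ∪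
      ({v ∈ S | blockDet v = 0 ∧ v 9 * v 12 - v 10 ^ 2 ≠ 0 ∧ minorDeleteZero v ≠ 0} ∪
      ({v ∈ S | blockDet v = 0 ∧ v 9 * v 12 - v 10 ^ 2 ≠ 0 ∧ minorDeleteZero v = 0} ∪
      ({v ∈ S | blockDet v = 0 ∧ v 9 * v 12 - v 10 ^ 2 = 0 ∧ v 12 ≠ 0} ∪
      {v ∈ S | v 9 * v 12 - v 10 ^ 2 = 0 ∧ v 12 = 0}))))) := by
    intro v hv
    have hJ := blockDet_mul_det v
    rw [h v hv, mul_zero] at hJ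
    have hprod : minorMixed v = 0 → minorDeleteOne v = 0 ∨ minorDeleteZero v = 0 := by
      intro h0
      rw [h0] at hJ
      exact mul_eq_zero.1 (by linarith)
    simp only [Finset.mem_union, Finset.mem_filter, hv, true_and]
    by_cases h1 : blockDet v = 0
    · by_cases h2 : v 9 * v 12 - v 10 ^ 2 = 0
      · by_cases h3 : v 12 = 0 <;> simp only [h2] <;> simp [h1, h3]
      · by_cases h3 : minorDeleteZero v = 0 <;> simp [h1, h2, h3]
    · by_cases h2 : minorMixed v = 0
      · rcases hprod h2 with h3 | h3 <;> simp [h1, h2, h3]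
      · simp [h1, h2]
  have b1 := card_le_of_blockDet_ne_zero_of_minorMixed_ne_zero (N := N) (c := c)
    (S := {v ∈ S | blockDet v ≠ 0 ∧ minorMixed v ≠ 0}) (hmem _)
    (fun v hv => hc v (Finset.mem_filter.1 hv).1 (Finset.mem_filter.1 hv).2.2)
    (fun v hv => ⟨h v (Finset.mem_filter.1 hv).1, (Finset.mem_filter.1 hv).2⟩)
  have b2 := card_le_of_minorDeleteOne_eq_zero (N := N)
    (S := {v ∈ S | blockDet v ≠ 0 ∧ minorMixed v = 0 ∧ minorDeleteOne v = 0})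
    (hmem _) (fun v hv => (Finset.mem_filter.1 hv).2)
  have b3 := card_le_of_minorDeleteZero_eq_zero (N := N)
    (S := {v ∈ S | blockDet v ≠ 0 ∧ minorMixed v = 0 ∧ minorDeleteZero v = 0})
    (hmem _) (fun v hv => (Finset.mem_filter.1 hv).2)
  have b4 := card_le_of_blockDet_eq_zero_of_minorDeleteZero_ne_zero (N := N)
    (S := {v ∈ S | blockDet v = 0 ∧ v 9 * v 12 - v 10 ^ 2 ≠ 0 ∧ minorDeleteZero v ≠ 0})
    (hmem _) (fun v hv => ⟨h v (Finset.mem_filter.1 hv).1, (Finset.mem_filter.1 hv).2⟩)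
  have b5 := card_le_of_blockDet_eq_zero_of_minorDeleteZero_eq_zero (N := N)
    (S := {v ∈ S | blockDet v = 0 ∧ v 9 * v 12 - v 10 ^ 2 ≠ 0 ∧ minorDeleteZero v = 0})
    (hmem _) (fun v hv => (Finset.mem_filter.1 hv).2)
  have b6 := card_le_of_minor_eq_zero_of_entry_ne_zero (N := N)
    (S := {v ∈ S | blockDet v = 0 ∧ v 9 * v 12 - v 10 ^ 2 = 0 ∧ v 12 ≠ 0})
    (hmem _) (fun v hv => (Finset.mem_filter.1 hv).2)
  have b7 := card_le_of_minor_eq_zero_of_entry_eq_zero (N := N)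
    (S := {v ∈ S | v 9 * v 12 - v 10 ^ 2 = 0 ∧ v 12 = 0})
    (hmem _) (fun v hv => (Finset.mem_filter.1 hv).2)
  generalize (2 * N + 1) ^ 13 = m at *
  refine (Finset.card_le_card hcover).trans ?_
  calc _ ≤ c * m + (1 * m + (1 * m + (1 * m + (2 * m + (2 * m + 1 * m))))) :=
        (Finset.card_union_le _ _).trans <| Nat.add_le_add b1 <|
        (Finset.card_union_le _ _).trans <| Nat.add_le_add b2 <|
        (Finset.card_union_le _ _).trans <| Nat.add_le_add b3 <|
        (Finset.card_union_le _ _).trans <| Nat.add_le_add b4 <|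
        (Finset.card_union_le _ _).trans <| Nat.add_le_add b5 <|
        (Finset.card_union_le _ _).trans <| Nat.add_le_add b6 b7
    _ = (c + 8) * m := by ring

end CardBounds

theorem exists_card_det_symmOfUpper_eq_zero_le :
    ∃ C : ℝ, 0 < C ∧ ∀ (N : ℕ) (S : Finset (Fin 15 → ℤ)), 1 ≤ N →
      (∀ v ∈ S, ∀ k, |v k| ≤ N) → (∀ v ∈ S, (symmOfUpper v).det = 0) →
      (S.card : ℝ) ≤ C * (N : ℝ) ^ (13 + 1 / 5 : ℝ) := by
  obtain ⟨C₀, -, hC₀⟩ := exists_card_divisors_pow_le 40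
  let R : ℝ := (576 * C₀ : ℝ) ^ (1 / 40 : ℝ)
  have hR : 0 ≤ R := by positivity
  refine ⟨(2 * R + 8) * 3 ^ 13, by positivity, fun N S hN hS hdet => ?_⟩
  have hN' : (1 : ℝ) ≤ N := by exact_mod_cast hN
  have hNp : (1 : ℝ) ≤ (N : ℝ) ^ (1 / 5 : ℝ) := Real.one_le_rpow hN' (by norm_num)
  have hdiv : ∀ v ∈ S, minorMixed v ≠ 0 →
      2 * (minorMixed v ^ 2).natAbs.divisors.card ≤ ⌊2 * (R * (N : ℝ) ^ (1 / 5 : ℝ))⌋₊ := by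
    intro v hv hne
    have h1 := hC₀ (minorMixed v ^ 2).natAbs (Int.natAbs_ne_zero.2 (pow_ne_zero 2 hne))
    have h2 : (minorMixed v ^ 2).natAbs ≤ 576 * N ^ 8 := by
      zify
      rw [abs_pow]
      calc |minorMixed v| ^ 2 ≤ (24 * (N : ℤ) ^ 4) ^ 2 := by
            gcongr; exact abs_minorMixed_le (hS v hv)
        _ = _ := by ring
    have h3 : ((minorMixed v ^ 2).natAbs.divisors.card : ℝ) ^ 40 ≤ 576 * C₀ * (N : ℝ) ^ 8 := by
      have : (minorMixed v ^ 2).natAbs.divisors.card ^ 40 ≤ 576 * C₀ * N ^ 8 :=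
        h1.trans (by nlinarith [Nat.mul_le_mul_left C₀ h2])
      exact_mod_cast this
    have h4 : ((minorMixed v ^ 2).natAbs.divisors.card : ℝ) ≤ R * (N : ℝ) ^ (1 / 5 : ℝ) := by
      refine le_of_pow_le_pow_left₀ (n := 40) (by norm_num) (by positivity) (h3.trans_eq ?_)
      simp only [R]
      rw [mul_pow, ← Real.rpow_natCast, ← Real.rpow_natCast, ← Real.rpow_natCast,
        ← Real.rpow_mul (by positivity), ← Real.rpow_mul (by positivity)]
      norm_num
    apply Nat.le_floor
    push_cast
    linarith
  have hcard := card_le_of_det_symmOfUpper_eq_zero hS hdiv hdet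
  have hfloor := Nat.floor_le (show 0 ≤ 2 * (R * (N : ℝ) ^ (1 / 5 : ℝ)) by positivity)
  calc (S.card : ℝ) ≤ (⌊2 * (R * (N : ℝ) ^ (1 / 5 : ℝ))⌋₊ + 8) * (2 * N + 1) ^ 13 := by
        exact_mod_cast hcard
    _ ≤ ((2 * R + 8) * (N : ℝ) ^ (1 / 5 : ℝ)) * (3 * N) ^ 13 := by
        gcongr
        · linarith
        · linarith
    _ = (2 * R + 8) * 3 ^ 13 * (N : ℝ) ^ (13 + 1 / 5 : ℝ) := by
        rw [Real.rpow_add (by positivity), mul_pow,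
          show (N : ℝ) ^ (13 : ℝ) = (N : ℝ) ^ 13 by rw [← Real.rpow_natCast]; norm_num]
        ring

/-- The entries on and above the diagonal, row by row. -/
def upperEntries (M : Matrix (Fin 5) (Fin 5) ℤ) : Fin 15 → ℤ :=
  ![M 0 0, M 0 1, M 0 2, M 0 3, M 0 4, M 1 1, M 1 2, M 1 3, M 1 4, M 2 2, M 2 3, M 2 4,
    M 3 3, M 3 4, M 4 4]

theorem symmOfUpper_upperEntries {M : Matrix (Fin 5) (Fin 5) ℤ} (hM : M.IsSymm) :
    symmOfUpper (upperEntries M) = M := by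
  ext i j
  fin_cases i <;> fin_cases j <;> first | rfl | exact hM.apply _ _

section RationalZero

variable {ι : Type*} [Fintype ι] [DecidableEq ι]

theorem exists_int_det_eq_zero_of_rat {A B : Matrix ι ι ℤ} {t : ℚ}
    (h : (t • A.map (Int.cast : ℤ → ℚ) + B.map (Int.cast : ℤ → ℚ)).det = 0) :
    ∃ z : ℤ, (z : ℚ) = t * A.det ∧ ((z : ℤ) • (1 : Matrix ι ι ℤ) + A.adjugate * B).det = 0 := by
  have h1 : A.adjugate.map (Int.cast : ℤ → ℚ) * A.map (Int.cast : ℤ → ℚ)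
      = (A.det : ℚ) • 1 := by
    have := congrArg (fun M : Matrix ι ι ℤ => M.map (Int.castRingHom ℚ)) (Matrix.adjugate_mul A)
    simp only [Matrix.map_mul] at this
    refine this.trans ?_
    ext i j
    by_cases hij : i = j <;> simp [-zsmul_eq_mul, -zsmul_one, hij]
  have h2 : ((t * A.det) • (1 : Matrix ι ι ℚ)
      + (A.adjugate * B).map (Int.castRingHom ℚ)).det = 0 := by
    have : (t * A.det) • (1 : Matrix ι ι ℚ) + (A.adjugate * B).map (Int.castRingHom ℚ)
        = A.adjugate.map (Int.cast : ℤ → ℚ) *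
          (t • A.map (Int.cast : ℤ → ℚ) + B.map (Int.cast : ℤ → ℚ)) := by
      rw [Matrix.map_mul, mul_add, Matrix.mul_smul, h1, smul_smul]
      rfl
    rw [this, Matrix.det_mul, h, mul_zero]
  have h3 : IsIntegral ℤ (t * A.det) := by
    refine ⟨(-(A.adjugate * B)).charpoly, Matrix.charpoly_monic _, ?_⟩
    rw [← Polynomial.eval_map, ← Matrix.charpoly_map, Matrix.eval_charpoly]
    convert h2 using 2
    ext i j
    by_cases hij : i = j <;> simp [hij, Matrix.scalar_apply]
  obtain ⟨z, hz⟩ := IsIntegrallyClosed.isIntegral_iff.1 h3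
  refine ⟨z, hz, ?_⟩
  have : Int.castRingHom ℚ (z • (1 : Matrix ι ι ℤ) + A.adjugate * B).det = 0 := by
    rw [RingHom.map_det, ← h2, ← hz]
    congr 1
    ext i j
    by_cases hij : i = j <;> simp [-zsmul_eq_mul, -zsmul_one, hij]
  simpa using this

theorem abs_le_of_det_smul_one_add_eq_zero {G : Matrix ι ι ℤ} {z s : ℤ}
    (h : (z • (1 : Matrix ι ι ℤ) + G).det = 0) (hs : ∀ i, ∑ j, |G i j| ≤ s) : |z| ≤ s := by
  by_contra! hz
  refine det_ne_zero_of_sum_row_lt_diag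
    (A := (z • (1 : Matrix ι ι ℤ) + G).map (Int.castRingHom ℝ)) (fun k => ?_) ?_
  · have h1 : ∑ j ∈ Finset.univ.erase k, ‖(z • (1 : Matrix ι ι ℤ) + G).map (Int.castRingHom ℝ) k j‖
        = ((∑ j ∈ Finset.univ.erase k, |G k j| : ℤ) : ℝ) := by
      push_cast
      refine Finset.sum_congr rfl fun j hj => ?_
      simp [-zsmul_eq_mul, -zsmul_one, Matrix.one_apply_ne (Finset.ne_of_mem_erase hj).symm]
    have h2 : ‖(z • (1 : Matrix ι ι ℤ) + G).map (Int.castRingHom ℝ) k k‖ = (|z + G k k| : ℤ) := by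
      simp [-zsmul_eq_mul, -zsmul_one]
    rw [h1, h2, Int.cast_lt]
    have h3 : |G k k| + ∑ j ∈ Finset.univ.erase k, |G k j| = ∑ j, |G k j| :=
      Finset.add_sum_erase _ (fun j => |G k j|) (Finset.mem_univ k)
    have h4 := hs k
    have h5 := abs_sub_abs_le_abs_sub z (-G k k)
    rw [abs_neg, sub_neg_eq_add] at h5
    linarith
  · have := RingHom.map_det (Int.castRingHom ℝ) (z • (1 : Matrix ι ι ℤ) + G)
    rw [h, map_zero] at this
    exact this.symm

theorem det_smul_add_det_smul_eq_zero {A B : Matrix ι ι ℤ} {z : ℤ}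
    (h : (z • (1 : Matrix ι ι ℤ) + A.adjugate * B).det = 0) :
    (z • A + A.det • B).det = 0 := by
  have h1 : A * (z • (1 : Matrix ι ι ℤ) + A.adjugate * B) = z • A + A.det • B := by
    rw [mul_add, Matrix.mul_smul, mul_one, ← Matrix.mul_assoc, Matrix.mul_adjugate,
      Matrix.smul_mul, one_mul]
  rw [← h1, Matrix.det_mul, h, mul_zero]

theorem exists_bounded_int_det_eq_zero (A : Matrix ι ι ℤ) :
    ∃ K : ℕ, ∀ (n : ℕ) (B : Matrix ι ι ℤ) (t : ℚ), (∀ i j, |B i j| ≤ n) →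
      (t • A.map (Int.cast : ℤ → ℚ) + B.map (Int.cast : ℤ → ℚ)).det = 0 →
      ∃ z : ℤ, |z| ≤ K * n ∧ (z • A + A.det • B).det = 0 ∧
        ∀ i j, |(z • A + A.det • B) i j| ≤ K * n := by
  let a : ℤ := ∑ i, ∑ j, |A.adjugate i j|
  let b : ℤ := ∑ i, ∑ j, |A i j|
  let r : ℤ := Fintype.card ι * a
  have ha : 0 ≤ a := by positivity
  have hb : 0 ≤ b := by positivity
  have hr : 0 ≤ r := by positivity
  have hentry : ∀ (M : Matrix ι ι ℤ) i j, |M i j| ≤ ∑ i, ∑ j, |M i j| := fun M i j =>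
    (Finset.single_le_sum (f := fun j => |M i j|) (fun _ _ => abs_nonneg _)
      (Finset.mem_univ j)).trans
    (Finset.single_le_sum (f := fun i => ∑ j, |M i j|)
      (fun _ _ => Finset.sum_nonneg fun _ _ => abs_nonneg _) (Finset.mem_univ i))
  have hrow : ∀ (M : Matrix ι ι ℤ) i, ∑ j, |M i j| ≤ ∑ i, ∑ j, |M i j| := fun M i =>
    Finset.single_le_sum (f := fun i => ∑ j, |M i j|)
      (fun _ _ => Finset.sum_nonneg fun _ _ => abs_nonneg _) (Finset.mem_univ i)
  refine ⟨(r + (r * b + |A.det|)).toNat, fun n B t hB ht => ?_⟩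
  rw [Int.toNat_of_nonneg (by positivity)]
  obtain ⟨z, -, hz⟩ := exists_int_det_eq_zero_of_rat ht
  have hzr : |z| ≤ r * n := by
    refine abs_le_of_det_smul_one_add_eq_zero hz fun i => ?_
    calc ∑ j, |(A.adjugate * B) i j| ≤ ∑ _j : ι, a * n := by
          refine Finset.sum_le_sum fun j _ => ?_
          rw [Matrix.mul_apply]
          refine (Finset.abs_sum_le_sum_abs _ _).trans ?_
          calc ∑ k, |A.adjugate i k * B k j| ≤ ∑ k, |A.adjugate i k| * n := by
                refine Finset.sum_le_sum fun k _ => ?_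
                rw [abs_mul]
                exact mul_le_mul_of_nonneg_left (hB k j) (abs_nonneg _)
            _ = (∑ k, |A.adjugate i k|) * n := by rw [Finset.sum_mul]
            _ ≤ a * n := mul_le_mul_of_nonneg_right (hrow _ i) (by positivity)
      _ = r * n := by simp [r, mul_assoc]
  refine ⟨z, hzr.trans ?_, det_smul_add_det_smul_eq_zero hz, fun i j => ?_⟩
  · gcongr
    have := abs_nonneg A.det
    nlinarith [mul_nonneg hr hb]
  · calc |(z • A + A.det • B) i j| ≤ |z| * |A i j| + |A.det| * |B i j| := by
          rw [← abs_mul, ← abs_mul]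
          exact abs_add_le (z * A i j) (A.det * B i j)
      _ ≤ r * n * b + |A.det| * n := by gcongr; exacts [hentry A i j, hB i j]
      _ ≤ _ := by nlinarith [mul_nonneg hr (Nat.cast_nonneg (α := ℤ) n)]

end RationalZero

theorem exists_rat_det_eq_zero_of_charForm {A B : Matrix (Fin 5) (Fin 5) ℤ} (hA : A.det ≠ 0)
    {l m : ℚ} (hlm : (l, m) ≠ (0, 0)) (h : MvPolynomial.eval ![l, m] (charForm A B) = 0) :
    ∃ t : ℚ, (t • A.map (Int.cast : ℤ → ℚ) + B.map (Int.cast : ℤ → ℚ)).det = 0 := by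
  have h1 : (l • A.map (Int.cast : ℤ → ℚ) + m • B.map (Int.cast : ℤ → ℚ)).det = 0 := by
    rw [← h, charForm, RingHom.map_det]
    congr 1
    ext i j
    simp
  have hm : m ≠ 0 := by
    rintro rfl
    have hl : l ≠ 0 := fun hl => hlm (by rw [hl])
    have h2 : (A.map (Int.cast : ℤ → ℚ)).det = A.det := (RingHom.map_det (Int.castRingHom ℚ) A).symm
    rw [zero_smul, add_zero, Matrix.det_smul, h2] at h1
    simp [hl, hA] at h1
  refine ⟨l / m, ?_⟩
  have h3 : l • A.map (Int.cast : ℤ → ℚ) + m • B.map (Int.cast : ℤ → ℚ)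
      = m • ((l / m) • A.map (Int.cast : ℤ → ℚ) + B.map (Int.cast : ℤ → ℚ)) := by
    rw [smul_add, smul_smul, mul_div_cancel₀ _ hm]
  rw [h3, Matrix.det_smul] at h1
  exact (mul_eq_zero.1 h1).resolve_left (pow_ne_zero _ hm)

/-- For a fixed symmetric integer `5×5` matrix `A` with `det A ≠ 0` and every `ε > 0`,
the number of symmetric integer matrices `B` with entries bounded by `P` such that
`f(λ,μ) = det(λA + μB)` has a nontrivial rational zero is `≪ P^(14 + 1/5 + ε)`. -/
theorem frequency_rational_root (A : Matrix (Fin 5) (Fin 5) ℤ) (hA : A.IsSymm)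
    (hdet : A.det ≠ 0) :
    ∀ ε : ℝ, 0 < ε → ∃ C : ℝ, 0 < C ∧ ∀ P : ℝ, 1 ≤ P →
      (Nat.card {B : Matrix (Fin 5) (Fin 5) ℤ //
          B.IsSymm ∧ (∀ i j : Fin 5, (|B i j| : ℝ) ≤ P) ∧
          ∃ l m : ℚ, (l, m) ≠ (0, 0) ∧ MvPolynomial.eval ![l, m] (charForm A B) = 0} : ℝ)
        ≤ C * P ^ ((14 : ℝ) + 1 / 5 + ε) := by
  intro ε hε
  obtain ⟨C, hC, hcount⟩ := exists_card_det_symmOfUpper_eq_zero_le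
  obtain ⟨K, hK⟩ := exists_bounded_int_det_eq_zero A
  refine ⟨(2 * K + 1) * (C * (K + 1 : ℝ) ^ (13 + 1 / 5 : ℝ)), by positivity, fun P hP => ?_⟩
  set n := ⌊P⌋₊ with hn
  have hn1 : 1 ≤ n := Nat.le_floor (by simpa using hP)
  have hnP : (n : ℝ) ≤ P := Nat.floor_le (by linarith)
  let N := (K + 1) * n
  let S : Finset (Fin 15 → ℤ) := {v ∈ Fintype.piFinset fun _ => Finset.Icc (-(N : ℤ)) N |
    (symmOfUpper v).det = 0}
  let Z : Finset ℤ := Finset.Icc (-((K * n : ℕ) : ℤ)) (K * n : ℕ)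
  have hS : (S.card : ℝ) ≤ C * (N : ℝ) ^ (13 + 1 / 5 : ℝ) := by
    refine hcount N S (Nat.mul_pos K.succ_pos hn1) (fun v hv k => ?_)
      fun v hv => (Finset.mem_filter.1 hv).2
    exact abs_le.2 (Finset.mem_Icc.1 (Fintype.mem_piFinset.1 (Finset.mem_filter.1 hv).1 k))
  have hZ : Z.card = 2 * (K * n) + 1 := by
    rw [Int.card_Icc]; omega
  have hz : ∀ B : {B : Matrix (Fin 5) (Fin 5) ℤ //
      B.IsSymm ∧ (∀ i j : Fin 5, (|B i j| : ℝ) ≤ P) ∧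
      ∃ l m : ℚ, (l, m) ≠ (0, 0) ∧ MvPolynomial.eval ![l, m] (charForm A B) = 0},
      ∃ z : ℤ, z ∈ Z ∧ upperEntries (z • A + A.det • B.1) ∈ S := by
    rintro ⟨B, hB, hBP, l, m, hlm, h⟩
    obtain ⟨t, ht⟩ := exists_rat_det_eq_zero_of_charForm hdet hlm h
    have hBn : ∀ i j, |B i j| ≤ n := by
      intro i j
      have : (B i j).natAbs ≤ n := Nat.le_floor (by simpa using hBP i j)
      rw [Int.abs_eq_natAbs]
      exact_mod_cast this
    obtain ⟨z, hz1, hz2, hz3⟩ := hK n B t hBn ht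
    refine ⟨z, by simpa [Z] using abs_le.1 hz1, ?_⟩
    have hsymm : (z • A + A.det • B).IsSymm := (hA.smul z).add (hB.smul A.det)
    simp only [S, Finset.mem_filter, Fintype.mem_piFinset, Finset.mem_Icc]
    refine ⟨fun k => ?_, by rw [symmOfUpper_upperEntries hsymm, hz2]⟩
    have hz4 : ∀ i j, |(z • A + A.det • B) i j| ≤ N := fun i j =>
      (hz3 i j).trans (by simp only [N]; push_cast; gcongr; omega)
    rw [← abs_le]
    fin_cases k <;> exact hz4 _ _
  choose z hzZ hzS using hz
  have hcard := Nat.card_le_card_of_injective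
    (fun B => (⟨(z B, upperEntries (z B • A + A.det • B.1)),
      Finset.mk_mem_product (hzZ B) (hzS B)⟩ : ↥(Z ×ˢ S))) (by
    intro B B' h
    simp only [Subtype.mk.injEq, Prod.mk.injEq] at h
    have h1 : z B • A + A.det • B.1 = z B' • A + A.det • B'.1 := by
      rw [← symmOfUpper_upperEntries ((hA.smul (z B)).add (B.2.1.smul A.det)), h.2,
        symmOfUpper_upperEntries ((hA.smul (z B')).add (B'.2.1.smul A.det))]
    rw [h.1] at h1
    exact Subtype.ext (smul_right_injective _ hdet (add_left_cancel h1)))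
  rw [Nat.card_eq_fintype_card (α := ↥(Z ×ˢ S)), Fintype.card_coe, Finset.card_product, hZ] at hcard
  have hn1' : (1 : ℝ) ≤ n := by exact_mod_cast hn1
  have hP0 : 0 < P := by linarith
  have hpow : P ^ (14 + 1 / 5 : ℝ) = P * P ^ (13 + 1 / 5 : ℝ) := by
    rw [show (14 + 1 / 5 : ℝ) = 1 + (13 + 1 / 5) by norm_num, Real.rpow_add hP0 1, Real.rpow_one]
  calc _ ≤ ((2 * (K * n) + 1 : ℕ) : ℝ) * S.card := by exact_mod_cast hcard
    _ ≤ ((2 * K + 1) * n) * (C * (N : ℝ) ^ (13 + 1 / 5 : ℝ)) := by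
        gcongr
        push_cast
        linarith
    _ ≤ ((2 * K + 1) * P) * (C * ((K + 1) * P) ^ (13 + 1 / 5 : ℝ)) := by
        simp only [N]
        push_cast
        gcongr
    _ = (2 * K + 1) * (C * (K + 1 : ℝ) ^ (13 + 1 / 5 : ℝ)) * P ^ (14 + 1 / 5 : ℝ) := by
        rw [Real.mul_rpow (by positivity) hP0.le, hpow]
        ring
    _ ≤ _ := by
        exact mul_le_mul_of_nonneg_left (Real.rpow_le_rpow_of_exponent_le hP (by linarith))
          (by positivity)
end
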